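/- arXiv:cs/0507018 — 5 statements merged into one kernel-verified Lean document; each statement's English description precedes it below -/
import Mathlib

section
/- Let σ > 0, θ > 0, and let r : ℤ → ℝ satisfy r(0) = 1, r(−k) = r(k), Σ_k |r(k)| < ∞, with spectral density f_s(ω) = Σ_{k∈ℤ} r(k)e^{−ikω} satisfying 0 ≤ f_s(ω) ≤ M for all ω, and suppose each Toeplitz matrix Σ_{s,n} = (r(i−j))_{1≤i,j≤n} is positive semidefinite. Let Q_n = σ⁻²I − (σ²I + θ²Σ_{s,n})⁻¹ and define T_{o,n}(y) = (1/n)[(1/2)·log(det(σ²I)/det(σ²I+θ²Σ_{s,n})) + (1/2)·yᵀQ_n y]. For each n let y_n ~ N(0, σ²I + θ²Σ_{s,n}) (hypothesis H₁). Then for every real t with t·θ²M/σ² < 1, lim_{n→∞} (1/n)·log E[exp(n·t·T_{o,n}(y_n))] = (t/4π)∫₀^{2π} log(σ²/(σ²+θ²f_s(ω))) dω − (1/4π)∫₀^{2π} log(1 − t·θ²f_s(ω)/σ²) dω. -/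
open MeasureTheory Matrix ProbabilityTheory Filter Topology

lemma integral_exp_half_mul_sq_gaussianReal {d : ℝ} (hd : d < 1) :
    ∫ x, Real.exp (1 / 2 * (d * x ^ 2)) ∂(gaussianReal 0 1) = (√(1 - d))⁻¹ := by
  rw [integral_gaussianReal_eq_integral_smul one_ne_zero]
  have h : ∀ x : ℝ, gaussianPDFReal 0 1 x • Real.exp (1 / 2 * (d * x ^ 2))
      = (√(2 * Real.pi))⁻¹ * Real.exp (-((1 - d) / 2) * x ^ 2) := by
    intro x
    simp only [gaussianPDFReal, NNReal.coe_one, smul_eq_mul, mul_one, sub_zero]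
    rw [mul_assoc, ← Real.exp_add]
    ring_nf
  simp_rw [h]
  rw [integral_const_mul, integral_gaussian, ← Real.sqrt_inv, ← Real.sqrt_inv,
    ← Real.sqrt_mul (by positivity)]
  have : 1 - d ≠ 0 := by linarith
  congr 1
  field_simp

section Spectral

variable {ι : Type*} [Fintype ι]

/-- The law of `∑ i, x i • b i` for standard Gaussian coordinates and an orthonormal basis `b`
is the standard Gaussian product law. -/
lemma integral_pi_gaussianReal_comp_orthonormalBasis
    (b : OrthonormalBasis ι ℝ (EuclideanSpace ℝ ι)) {F : (ι → ℝ) → ℝ} (hF : Continuous F) :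
    ∫ z, F z ∂(Measure.pi fun _ : ι => gaussianReal 0 1)
      = ∫ x, F (∑ i, x i • b i : EuclideanSpace ℝ ι).ofLp
          ∂(Measure.pi fun _ : ι => gaussianReal 0 1) := by
  have h := (map_pi_eq_stdGaussian (ι := ι)).trans (stdGaussian_eq_map_pi_orthonormalBasis b)
  have hF' : Continuous fun y : EuclideanSpace ℝ ι => F y.ofLp := by fun_prop
  have h2 := congrArg (fun μ => ∫ y : EuclideanSpace ℝ ι, F y.ofLp ∂μ) h
  simp only at h2
  have hb : Continuous fun x : ι → ℝ => ∑ i, x i • b i := by fun_prop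
  rw [integral_map (by fun_prop) (hF'.aestronglyMeasurable),
    integral_map hb.aemeasurable (hF'.aestronglyMeasurable)] at h2
  exact h2

variable [DecidableEq ι]

lemma det_one_sub_smul_eq_prod_eigenvalues {S : Matrix ι ι ℝ} (hS : S.IsHermitian) (c : ℝ) :
    (1 - c • S).det = ∏ i, (1 - c * hS.eigenvalues i) := by
  have h := hS.spectral_theorem
  rw [Unitary.conjStarAlgAut_apply] at h
  set U := hS.eigenvectorUnitary
  set D : Matrix ι ι ℝ := diagonal (RCLike.ofReal ∘ hS.eigenvalues)
  have hD : 1 - c • D = diagonal fun i => 1 - c * hS.eigenvalues i := by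
    ext i j
    by_cases hij : i = j <;> simp [D, diagonal, hij]
  calc (1 - c • S).det = (1 - (c • (U : Matrix ι ι ℝ) * D) * (star U : Matrix ι ι ℝ)).det := by
        conv_lhs => rw [h]
        simp
    _ = (1 - c • D).det := by
        rw [det_one_sub_mul_comm]
        simp [← mul_assoc]
    _ = _ := by rw [hD, det_diagonal]

lemma trace_pow_eq_sum_eigenvalues {S : Matrix ι ι ℝ} (hS : S.IsHermitian) (k : ℕ) :
    (S ^ k).trace = ∑ i, hS.eigenvalues i ^ k := by
  conv_lhs => rw [hS.spectral_theorem, ← map_pow, Unitary.conjStarAlgAut_apply, trace_mul_comm,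
    ← mul_assoc]
  simp [diagonal_pow, trace_diagonal]

lemma dotProduct_mulVec_sum_smul_eigenvectorBasis {G : Matrix ι ι ℝ} (hG : G.IsHermitian)
    (x : ι → ℝ) :
    (∑ i, x i • hG.eigenvectorBasis i : EuclideanSpace ℝ ι).ofLp
        ⬝ᵥ G *ᵥ (∑ i, x i • hG.eigenvectorBasis i : EuclideanSpace ℝ ι).ofLp
      = ∑ i, hG.eigenvalues i * x i ^ 2 := by
  have hb : ∀ i j, (hG.eigenvectorBasis i).ofLp ⬝ᵥ (hG.eigenvectorBasis j).ofLp
      = if i = j then 1 else 0 := by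
    intro i j
    have := orthonormal_iff_ite.mp hG.eigenvectorBasis.orthonormal j i
    rw [EuclideanSpace.inner_eq_star_dotProduct] at this
    simpa [eq_comm] using this
  simp only [WithLp.ofLp_sum, WithLp.ofLp_smul, mulVec_sum, mulVec_smul,
    hG.mulVec_eigenvectorBasis, sum_dotProduct, dotProduct_sum, smul_dotProduct,
    dotProduct_smul, hb, smul_eq_mul]
  refine Finset.sum_congr rfl fun i _ => ?_
  rw [Finset.sum_eq_single i (by intro j _ hj; simp [hj]) (by simp)]
  simp
  ring

/-- Moment generating function of a quadratic form in independent standard Gaussians. -/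
lemma integral_exp_half_quadratic_pi_gaussianReal {G : Matrix ι ι ℝ} (hG : G.IsHermitian)
    (h : ∀ i, hG.eigenvalues i < 1) :
    ∫ z, Real.exp (1 / 2 * (z ⬝ᵥ G *ᵥ z)) ∂(Measure.pi fun _ : ι => gaussianReal 0 1)
      = (√((1 - G).det))⁻¹ := by
  rw [integral_pi_gaussianReal_comp_orthonormalBasis hG.eigenvectorBasis
    (F := fun z => Real.exp (1 / 2 * (z ⬝ᵥ G *ᵥ z))) (by fun_prop)]
  simp_rw [dotProduct_mulVec_sum_smul_eigenvectorBasis hG, Finset.mul_sum, Real.exp_sum]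
  rw [integral_fintype_prod_eq_prod
    (f := fun i x => Real.exp (1 / 2 * (hG.eigenvalues i * x ^ 2)))]
  simp_rw [fun i => integral_exp_half_mul_sq_gaussianReal (h i)]
  have hdet := det_one_sub_smul_eq_prod_eigenvalues hG 1
  simp only [one_smul, one_mul] at hdet
  rw [hdet, Finset.prod_inv_distrib, Real.sqrt_prod]
  exact fun i _ => by linarith [h i]

end Spectral

section Toeplitz

/-- The `n × n` Toeplitz matrix with symbol sequence `r`. -/
abbrev toeplitz (r : ℤ → ℝ) (n : ℕ) : Matrix (Fin n) (Fin n) ℝ :=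
  Matrix.of fun i j : Fin n => r ((i.val : ℤ) - (j.val : ℤ))

lemma integral_exp_int_mul (m : ℤ) :
    ∫ ω in (0 : ℝ)..(2 * Real.pi), Complex.exp (-Complex.I * m * ω)
      = if m = 0 then 2 * Real.pi else 0 := by
  split_ifs with h
  · simp [h]
  · rw [integral_exp_mul_complex (by simp [h])]
    have : -Complex.I * m * ((2 * Real.pi : ℝ) : ℂ) = ((-m : ℤ) : ℂ) * (2 * Real.pi * Complex.I) := by
      push_cast; ring
    rw [this, Complex.exp_int_mul_two_pi_mul_I]
    simp

lemma norm_exp_neg_I_int_mul (m : ℤ) (ω : ℝ) : ‖Complex.exp (-Complex.I * m * ω)‖ = 1 := by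
  have : -Complex.I * m * ω = ((-(m * ω) : ℝ) : ℂ) * Complex.I := by push_cast; ring
  rw [this, Complex.norm_exp_ofReal_mul_I]

variable {r : ℤ → ℝ} {f : ℝ → ℝ}

lemma norm_fourier_term (k : ℤ) (ω : ℝ) :
    ‖(r k : ℂ) * Complex.exp (-Complex.I * k * ω)‖ = |r k| := by
  rw [norm_mul, norm_exp_neg_I_int_mul, mul_one, Complex.norm_real, Real.norm_eq_abs]

lemma summable_norm_fourier_term (hsum : Summable fun k => |r k|) (ω : ℝ) :
    Summable fun k : ℤ => ‖(r k : ℂ) * Complex.exp (-Complex.I * k * ω)‖ := by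
  simpa only [norm_fourier_term] using hsum

lemma continuous_of_summable_fourier (hsum : Summable fun k => |r k|)
    (hf : ∀ ω : ℝ, (f ω : ℂ) = ∑' k : ℤ, (r k : ℂ) * Complex.exp (-Complex.I * k * ω)) :
    Continuous f := by
  have h : Continuous fun ω : ℝ => ∑' k : ℤ, (r k : ℂ) * Complex.exp (-Complex.I * k * ω) := by
    refine continuous_tsum (fun k => by fun_prop) hsum fun k ω => ?_
    exact (norm_fourier_term k ω).le
  simp_rw [← hf] at h
  exact Complex.continuous_re.comp h

lemma abs_le_tsum_of_fourier (hsum : Summable fun k => |r k|)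
    (hf : ∀ ω : ℝ, (f ω : ℂ) = ∑' k : ℤ, (r k : ℂ) * Complex.exp (-Complex.I * k * ω)) (ω : ℝ) :
    |f ω| ≤ ∑' k, |r k| := by
  have := norm_tsum_le_tsum_norm (summable_norm_fourier_term hsum ω)
  rw [← hf] at this
  simpa only [norm_fourier_term, Complex.norm_real, Real.norm_eq_abs] using this

/-- Fourier inversion for absolutely summable coefficients. -/
lemma integral_mul_exp_eq_coeff (hsum : Summable fun k => |r k|)
    (hf : ∀ ω : ℝ, (f ω : ℂ) = ∑' k : ℤ, (r k : ℂ) * Complex.exp (-Complex.I * k * ω)) (m : ℤ) :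
    ∫ ω in (0 : ℝ)..(2 * Real.pi), (f ω : ℂ) * Complex.exp (-Complex.I * (-m : ℤ) * ω)
      = 2 * Real.pi * r m := by
  have key : HasSum (fun k : ℤ => ∫ ω in (0 : ℝ)..(2 * Real.pi),
      (r k : ℂ) * Complex.exp (-Complex.I * (k - m : ℤ) * ω))
      (∫ ω in (0 : ℝ)..(2 * Real.pi), (f ω : ℂ) * Complex.exp (-Complex.I * (-m : ℤ) * ω)) := by
    refine intervalIntegral.hasSum_integral_of_dominated_convergence (fun k _ => |r k|)
      (fun k => (Continuous.aestronglyMeasurable (by fun_prop))) ?_ ?_ ?_ ?_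
    · exact fun k => ae_of_all _ fun ω _ => by
        rw [norm_mul, norm_exp_neg_I_int_mul]; simp
    · exact ae_of_all _ fun ω _ => hsum
    · exact intervalIntegrable_const
    · refine ae_of_all _ fun ω _ => ?_
      rw [hf ω]
      have hk : ∀ k : ℤ, (r k : ℂ) * Complex.exp (-Complex.I * (k - m : ℤ) * ω)
          = r k * Complex.exp (-Complex.I * k * ω)
            * Complex.exp (-Complex.I * (-m : ℤ) * ω) := by
        intro k
        rw [mul_assoc (r k : ℂ), ← Complex.exp_add]
        congr 2
        push_cast
        ring
      simp_rw [hk]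
      exact ((summable_norm_fourier_term hsum ω).of_norm.hasSum).mul_right _
  simp_rw [intervalIntegral.integral_const_mul, integral_exp_int_mul] at key
  refine key.unique ?_
  convert hasSum_ite_eq m (2 * Real.pi * r m : ℂ) using 2 with k
  by_cases hk : k = m
  · simp [hk, mul_comm]
  · simp [hk, sub_eq_zero]

/-- An upper bound on the symbol bounds the Toeplitz quadratic form. -/
lemma toeplitz_quadratic_le (hsum : Summable fun k => |r k|)
    (hf : ∀ ω : ℝ, (f ω : ℂ) = ∑' k : ℤ, (r k : ℂ) * Complex.exp (-Complex.I * k * ω))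
    {M : ℝ} (hM : ∀ ω, f ω ≤ M) {n : ℕ} (x : Fin n → ℝ) :
    x ⬝ᵥ toeplitz r n *ᵥ x ≤ M * (x ⬝ᵥ x) := by
  have hfc := continuous_of_summable_fourier hsum hf
  set p : ℝ → ℂ := fun ω => ∑ j : Fin n, (x j : ℂ) * Complex.exp (-Complex.I * (j : ℤ) * ω)
  have hpc : Continuous p := by fun_prop
  have hp : ∀ ω, ((‖p ω‖ ^ 2 : ℝ) : ℂ) = ∑ i : Fin n, ∑ j : Fin n,
      (x i * x j : ℂ) * Complex.exp (-Complex.I * (-((i : ℤ) - j) : ℤ) * ω) := by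
    intro ω
    rw [Complex.ofReal_pow, ← Complex.conj_mul']
    simp only [p, map_sum, Finset.sum_mul_sum]
    refine Finset.sum_congr rfl fun i _ => Finset.sum_congr rfl fun j _ => ?_
    rw [map_mul, ← Complex.exp_conj, Complex.conj_ofReal, mul_mul_mul_comm, ← Complex.exp_add]
    congr 2
    simp
    ring
  have hnn : 0 ≤ ∫ ω in (0 : ℝ)..(2 * Real.pi), (M - f ω) * ‖p ω‖ ^ 2 :=
    intervalIntegral.integral_nonneg (by positivity) fun ω _ =>
      mul_nonneg (by linarith [hM ω]) (by positivity)
  have hval : ((∫ ω in (0 : ℝ)..(2 * Real.pi), (M - f ω) * ‖p ω‖ ^ 2 : ℝ) : ℂ)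
      = ((2 * Real.pi * (M * (x ⬝ᵥ x) - x ⬝ᵥ toeplitz r n *ᵥ x) : ℝ) : ℂ) := by
    rw [← intervalIntegral.integral_ofReal]
    simp_rw [Complex.ofReal_mul, hp, Finset.mul_sum]
    rw [intervalIntegral.integral_finsetSum
      (fun i _ => Continuous.intervalIntegrable (by fun_prop) _ _)]
    have hterm : ∀ i j : Fin n, ∫ ω in (0 : ℝ)..(2 * Real.pi), ((M - f ω : ℝ) : ℂ) *
        ((x i * x j : ℂ) * Complex.exp (-Complex.I * (-((i : ℤ) - j) : ℤ) * ω))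
        = x i * x j * ((if i = j then 2 * Real.pi * M else 0) - 2 * Real.pi * r (i - j)) := by
      intro i j
      have h1 : ∀ ω : ℝ, ((M - f ω : ℝ) : ℂ) *
        ((x i * x j : ℂ) * Complex.exp (-Complex.I * (-((i : ℤ) - j) : ℤ) * ω))
        = x i * x j * (M * Complex.exp (-Complex.I * (-((i : ℤ) - j) : ℤ) * ω)
          - f ω * Complex.exp (-Complex.I * (-((i : ℤ) - j) : ℤ) * ω)) := by
        intro ω; rw [Complex.ofReal_sub]; ring
      simp_rw [h1]
      rw [intervalIntegral.integral_const_mul, intervalIntegral.integral_sub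
        (Continuous.intervalIntegrable (by fun_prop) _ _)
        (Continuous.intervalIntegrable (by fun_prop) _ _), integral_mul_exp_eq_coeff hsum hf,
        intervalIntegral.integral_const_mul, integral_exp_int_mul]
      by_cases hij : i = j
      · simp [hij]; ring_nf; simp
      · have : (i : ℤ) ≠ j := fun h => hij (Fin.ext (by exact_mod_cast h))
        simp [hij, sub_eq_zero, this.symm]
    have hsw : ∀ i : Fin n, ∫ ω in (0 : ℝ)..(2 * Real.pi), ∑ j : Fin n, ((M - f ω : ℝ) : ℂ) *
        ((x i * x j : ℂ) * Complex.exp (-Complex.I * (-((i : ℤ) - j) : ℤ) * ω))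
        = ∑ j : Fin n,
          (x i * x j : ℂ) * ((if i = j then 2 * Real.pi * M else 0) - 2 * Real.pi * r (i - j)) := by
      intro i
      rw [intervalIntegral.integral_finsetSum
        (fun i _ => Continuous.intervalIntegrable (by fun_prop) _ _)]
      simp_rw [hterm]
    simp_rw [hsw]
    simp only [dotProduct, mulVec, of_apply, mul_sub, Finset.sum_sub_distrib,
      apply_ite Complex.ofReal, Complex.ofReal_zero, mul_ite, mul_zero,
      Finset.sum_ite_eq, Finset.mem_univ, if_true, Finset.mul_sum, Complex.ofReal_sub,
      Complex.ofReal_sum, Complex.ofReal_mul, Complex.ofReal_ofNat]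
    congr 1
    · exact Finset.sum_congr rfl fun i _ => by ring
    · exact Finset.sum_congr rfl fun i _ => Finset.sum_congr rfl fun j _ => by ring
  rw [Complex.ofReal_inj] at hval
  rw [hval] at hnn
  have := nonneg_of_mul_nonneg_right hnn (by positivity)
  linarith

/-- The total mass of `r` missed by the rows of its `n × n` Toeplitz matrix. -/
noncomputable def toeplitzTail (r : ℤ → ℝ) (n : ℕ) : ℝ :=
  ∑ i : Fin n, (∑' k, |r k| - ∑ j : Fin n, |r ((i.val : ℤ) - j.val)|)

lemma sub_injective_fin {n : ℕ} (i : Fin n) :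
    Function.Injective fun j : Fin n => (i.val : ℤ) - j.val := by
  intro a b h
  ext
  simp only at h
  omega

/-- The set of offsets `i - j` occurring in row `i` of an `n × n` Toeplitz matrix. -/
def rowOffsets {n : ℕ} (i : Fin n) : Finset ℤ :=
  Finset.univ.map ⟨_, sub_injective_fin i⟩

lemma sum_rowOffsets {E : Type*} [AddCommMonoid E] {n : ℕ} (i : Fin n) (g : ℤ → E) :
    ∑ k ∈ rowOffsets i, g k = ∑ j : Fin n, g ((i.val : ℤ) - j.val) := by
  rw [rowOffsets, Finset.sum_map]
  rfl

lemma row_sum_le_tsum (hsum : Summable fun k => |r k|) {n : ℕ} (i : Fin n) :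
    ∑ j : Fin n, |r ((i.val : ℤ) - j.val)| ≤ ∑' k, |r k| := by
  rw [← sum_rowOffsets i fun k => |r k|]
  exact hsum.sum_le_tsum _ fun _ _ => abs_nonneg _

lemma toeplitzTail_nonneg (hsum : Summable fun k => |r k|) (n : ℕ) : 0 ≤ toeplitzTail r n :=
  Finset.sum_nonneg fun i _ => sub_nonneg.mpr (row_sum_le_tsum hsum i)

lemma tendsto_toeplitzTail_div (hsum : Summable fun k => |r k|) :
    Tendsto (fun n : ℕ => toeplitzTail r n / n) atTop (𝓝 0) := by
  set C := ∑' k, |r k| with hC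
  set τ : ℕ → ℝ := fun m => C - ∑ k ∈ Finset.Icc (-(m : ℤ)) m, |r k| with hτ
  have hτ0 : ∀ m, 0 ≤ τ m := fun m =>
    sub_nonneg.mpr (hsum.sum_le_tsum _ fun _ _ => abs_nonneg _)
  have hIcc : Tendsto (fun m : ℕ => Finset.Icc (-(m : ℤ)) m) atTop atTop := by
    refine tendsto_atTop_finset_of_monotone (fun a b hab => ?_) fun k => ⟨k.natAbs, ?_⟩
    · exact Finset.Icc_subset_Icc (by omega) (by omega)
    · rw [Finset.mem_Icc]; omega
  have hτt : Tendsto τ atTop (𝓝 0) := by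
    simpa [hτ, hC] using (tendsto_const_nhds (x := C)).sub (hsum.hasSum.comp hIcc)
  have hrow : ∀ (n : ℕ) (i : Fin n) (m : ℕ), m ≤ i.val → m ≤ n - 1 - i.val →
      C - ∑ j : Fin n, |r ((i.val : ℤ) - j.val)| ≤ τ m := by
    intro n i m h1 h2
    refine sub_le_sub_left ?_ _
    rw [← sum_rowOffsets i fun k => |r k|]
    refine Finset.sum_le_sum_of_subset_of_nonneg ?_ fun _ _ _ => abs_nonneg _
    intro k hk
    rw [Finset.mem_Icc] at hk
    have hi := i.isLt
    simp only [rowOffsets, Finset.mem_map, Finset.mem_univ, true_and, Function.Embedding.coeFn_mk]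
    refine ⟨⟨(i.val - k).toNat, by omega⟩, ?_⟩
    simp only
    omega
  have hle : ∀ n, toeplitzTail r n ≤ 2 * ∑ m ∈ Finset.range n, τ m := by
    intro n
    calc toeplitzTail r n ≤ ∑ i : Fin n, (τ i.val + τ (n - 1 - i.val)) := by
          refine Finset.sum_le_sum fun i _ => ?_
          rcases le_total i.val (n - 1 - i.val) with h | h
          · linarith [hrow n i _ le_rfl h, hτ0 (n - 1 - i.val)]
          · linarith [hrow n i _ h le_rfl, hτ0 i.val]
      _ = _ := by
          rw [Fin.sum_univ_eq_sum_range (fun i => τ i + τ (n - 1 - i)), Finset.sum_add_distrib,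
            Finset.sum_range_reflect τ n, two_mul]
  have hces := (hτt.cesaro).const_mul 2
  rw [mul_zero] at hces
  refine squeeze_zero (fun n => div_nonneg (toeplitzTail_nonneg hsum n) n.cast_nonneg)
    (fun n => ?_) hces
  rw [div_eq_inv_mul, ← mul_assoc, mul_comm 2, mul_assoc]
  exact mul_le_mul_of_nonneg_left (hle n) (by positivity)

/-- The vector of the first `n` powers of `exp (I ω)`. -/
noncomputable def fourierVec (n : ℕ) (ω : ℝ) (j : Fin n) : ℂ :=
  Complex.exp (-Complex.I * (-(j.val : ℤ) : ℤ) * ω)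

lemma norm_fourierVec (n : ℕ) (ω : ℝ) (j : Fin n) : ‖fourierVec n ω j‖ = 1 :=
  norm_exp_neg_I_int_mul _ _

lemma fourierVec_mul_exp (n : ℕ) (ω : ℝ) (i j : Fin n) :
    fourierVec n ω i * Complex.exp (-Complex.I * ((i.val : ℤ) - j.val : ℤ) * ω)
      = fourierVec n ω j := by
  rw [fourierVec, fourierVec, ← Complex.exp_add]
  congr 1
  push_cast
  ring

/-- Fourier vectors are approximate eigenvectors of Toeplitz matrices. -/
lemma sum_norm_toeplitz_mulVec_fourierVec_sub_le (hsum : Summable fun k => |r k|)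
    (hf : ∀ ω : ℝ, (f ω : ℂ) = ∑' k : ℤ, (r k : ℂ) * Complex.exp (-Complex.I * k * ω))
    (n : ℕ) (ω : ℝ) :
    ∑ i, ‖((toeplitz r n).map Complex.ofReal *ᵥ fourierVec n ω) i - f ω * fourierVec n ω i‖
      ≤ toeplitzTail r n := by
  rw [toeplitzTail]
  refine Finset.sum_le_sum fun i _ => ?_
  set s := rowOffsets i
  set a : ℤ → ℂ := fun k => (r k : ℂ) * Complex.exp (-Complex.I * k * ω) with ha
  have hna : ∀ k, ‖a k‖ = |r k| := fun k => norm_fourier_term k ω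
  have hsn : Summable fun k => ‖a k‖ := summable_norm_fourier_term hsum ω
  have h1 : ((toeplitz r n).map Complex.ofReal *ᵥ fourierVec n ω) i
      = fourierVec n ω i * ∑ k ∈ s, a k := by
    rw [sum_rowOffsets, Finset.mul_sum, mulVec, dotProduct]
    refine Finset.sum_congr rfl fun j _ => ?_
    rw [← fourierVec_mul_exp n ω i j]
    simp only [Matrix.map_apply, Matrix.of_apply, ha]
    ring
  have h2 := hsn.of_norm.sum_add_tsum_subtype_compl s
  have h3 := hsn.sum_add_tsum_subtype_compl s
  have h4 : ∑ j : Fin n, |r ((i.val : ℤ) - j.val)| = ∑ k ∈ s, ‖a k‖ := by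
    rw [sum_rowOffsets]
    simp only [hna]
  have h5 : ∑' k, |r k| = ∑' k, ‖a k‖ := by simp only [hna]
  rw [h1, mul_comm (f ω : ℂ), ← mul_sub, norm_mul, norm_fourierVec, one_mul, hf ω, ← h2,
    sub_add_cancel_left, norm_neg, h4, h5, ← h3, add_sub_cancel_left]
  exact norm_tsum_le_tsum_norm (hsn.subtype _)

lemma sum_norm_toeplitz_mulVec_le (hsum : Summable fun k => |r k|) (hsymm : ∀ k, r (-k) = r k)
    {n : ℕ} (v : Fin n → ℂ) :
    ∑ i, ‖((toeplitz r n).map Complex.ofReal *ᵥ v) i‖ ≤ (∑' k, |r k|) * ∑ i, ‖v i‖ := by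
  calc ∑ i, ‖((toeplitz r n).map Complex.ofReal *ᵥ v) i‖
      ≤ ∑ i : Fin n, ∑ j : Fin n, |r ((j.val : ℤ) - i.val)| * ‖v j‖ := by
        refine Finset.sum_le_sum fun i _ => ?_
        rw [mulVec, dotProduct]
        refine (norm_sum_le _ _).trans_eq ?_
        refine Finset.sum_congr rfl fun j _ => ?_
        rw [norm_mul, Matrix.map_apply, Complex.norm_real, Real.norm_eq_abs,
          ← neg_sub (i.val : ℤ), hsymm]
        rfl
    _ = ∑ j : Fin n, (∑ i : Fin n, |r ((j.val : ℤ) - i.val)|) * ‖v j‖ := by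
        rw [Finset.sum_comm]
        simp_rw [Finset.sum_mul]
    _ ≤ _ := by
        rw [Finset.mul_sum]
        exact Finset.sum_le_sum fun j _ =>
          mul_le_mul_of_nonneg_right (row_sum_le_tsum hsum j) (norm_nonneg _)

lemma exists_sum_norm_toeplitz_pow_mulVec_fourierVec_sub_le (hsum : Summable fun k => |r k|)
    (hsymm : ∀ k, r (-k) = r k)
    (hf : ∀ ω : ℝ, (f ω : ℂ) = ∑' k : ℤ, (r k : ℂ) * Complex.exp (-Complex.I * k * ω))
    (k : ℕ) : ∃ K : ℝ, ∀ (n : ℕ) (ω : ℝ),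
    ∑ i, ‖((toeplitz r n ^ k).map Complex.ofReal *ᵥ fourierVec n ω) i
      - (f ω : ℂ) ^ k * fourierVec n ω i‖ ≤ K * toeplitzTail r n := by
  induction k with
  | zero =>
    refine ⟨0, fun n ω => ?_⟩
    simp [Matrix.map_one]
  | succ k ih =>
    obtain ⟨K, hK⟩ := ih
    set C := ∑' k, |r k|
    have hC : 0 ≤ C := tsum_nonneg fun _ => abs_nonneg _
    refine ⟨C * K + C ^ k, fun n ω => ?_⟩
    set S := (toeplitz r n).map Complex.ofReal
    set e := fourierVec n ω
    set w := (toeplitz r n ^ k).map Complex.ofReal *ᵥ e - (f ω : ℂ) ^ k • e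
    have hpow : (toeplitz r n ^ (k + 1)).map Complex.ofReal
        = S * (toeplitz r n ^ k).map Complex.ofReal := by
      rw [pow_succ']
      exact Matrix.map_mul (f := Complex.ofRealHom)
    have hsplit : ∀ i, ((toeplitz r n ^ (k + 1)).map Complex.ofReal *ᵥ e) i
        - (f ω : ℂ) ^ (k + 1) * e i = (S *ᵥ w) i + (f ω : ℂ) ^ k * ((S *ᵥ e) i - f ω * e i) := by
      intro i
      rw [hpow, ← mulVec_mulVec, mulVec_sub, mulVec_smul]
      simp only [Pi.sub_apply, Pi.smul_apply, smul_eq_mul]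
      ring
    have hfk : ‖(f ω : ℂ) ^ k‖ ≤ C ^ k := by
      rw [norm_pow, Complex.norm_real, Real.norm_eq_abs]
      exact pow_le_pow_left₀ (abs_nonneg _) (abs_le_tsum_of_fourier hsum hf ω) k
    calc _ ≤ ∑ i, (‖(S *ᵥ w) i‖ + ‖(f ω : ℂ) ^ k‖ * ‖(S *ᵥ e) i - f ω * e i‖) := by
          refine Finset.sum_le_sum fun i _ => ?_
          rw [hsplit, ← norm_mul]
          exact norm_add_le _ _
      _ = ∑ i, ‖(S *ᵥ w) i‖ + ‖(f ω : ℂ) ^ k‖ * ∑ i, ‖(S *ᵥ e) i - f ω * e i‖ := by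
          rw [Finset.sum_add_distrib, Finset.mul_sum]
      _ ≤ C * (K * toeplitzTail r n) + C ^ k * toeplitzTail r n := by
          refine add_le_add ((sum_norm_toeplitz_mulVec_le hsum hsymm w).trans ?_)
            (mul_le_mul hfk (sum_norm_toeplitz_mulVec_fourierVec_sub_le hsum hf n ω)
              (Finset.sum_nonneg fun _ _ => norm_nonneg _) (by positivity))
          exact mul_le_mul_of_nonneg_left (hK n ω) hC
      _ = _ := by ring

lemma integral_fourierVec_quadratic {n : ℕ} (N : Matrix (Fin n) (Fin n) ℝ) :
    ∫ ω in (0 : ℝ)..(2 * Real.pi),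
      ∑ i, (starRingEnd ℂ) (fourierVec n ω i) * (N.map Complex.ofReal *ᵥ fourierVec n ω) i
      = 2 * Real.pi * N.trace := by
  have h : ∀ ω : ℝ,
      ∑ i, (starRingEnd ℂ) (fourierVec n ω i) * (N.map Complex.ofReal *ᵥ fourierVec n ω) i
      = ∑ i : Fin n, ∑ j : Fin n,
        (N i j : ℂ) * Complex.exp (-Complex.I * ((i.val : ℤ) - j.val : ℤ) * ω) := by
    intro ω
    refine Finset.sum_congr rfl fun i _ => ?_
    rw [mulVec, dotProduct, Finset.mul_sum]
    refine Finset.sum_congr rfl fun j _ => ?_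
    rw [← fourierVec_mul_exp n ω i j, Matrix.map_apply]
    have hu : (starRingEnd ℂ) (fourierVec n ω i) * fourierVec n ω i = 1 := by
      rw [Complex.conj_mul', norm_fourierVec]
      simp
    linear_combination (N i j : ℂ)
      * Complex.exp (-Complex.I * ((i.val : ℤ) - j.val : ℤ) * ω) * hu
  simp_rw [h]
  rw [intervalIntegral.integral_finsetSum
    (fun i _ => Continuous.intervalIntegrable (by fun_prop) _ _)]
  have h2 : ∀ i : Fin n, ∫ ω in (0 : ℝ)..(2 * Real.pi), ∑ j : Fin n,
        (N i j : ℂ) * Complex.exp (-Complex.I * ((i.val : ℤ) - j.val : ℤ) * ω)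
      = 2 * Real.pi * N i i := by
    intro i
    rw [intervalIntegral.integral_finsetSum
      (fun i _ => Continuous.intervalIntegrable (by fun_prop) _ _)]
    simp_rw [intervalIntegral.integral_const_mul, integral_exp_int_mul]
    rw [Finset.sum_eq_single i]
    · simp [mul_comm]
    · intro j _ hj
      have : (i.val : ℤ) - j.val ≠ 0 := fun h => hj (Fin.ext (by omega))
      simp [this]
    · simp
  simp_rw [h2, ← Finset.mul_sum]
  simp [Matrix.trace]

/-- Convergence of the spectral moments of Toeplitz matrices. -/
lemma tendsto_trace_toeplitz_pow_div (hsum : Summable fun k => |r k|)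
    (hsymm : ∀ k, r (-k) = r k)
    (hf : ∀ ω : ℝ, (f ω : ℂ) = ∑' k : ℤ, (r k : ℂ) * Complex.exp (-Complex.I * k * ω))
    (k : ℕ) : Tendsto (fun n : ℕ => (toeplitz r n ^ k).trace / n) atTop
      (𝓝 ((2 * Real.pi)⁻¹ * ∫ ω in (0 : ℝ)..(2 * Real.pi), f ω ^ k)) := by
  have hfc := continuous_of_summable_fourier hsum hf
  obtain ⟨K, hK⟩ := exists_sum_norm_toeplitz_pow_mulVec_fourierVec_sub_le hsum hsymm hf k
  have hbound : ∀ n : ℕ, |2 * Real.pi * (toeplitz r n ^ k).trace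
      - n * ∫ ω in (0 : ℝ)..(2 * Real.pi), f ω ^ k| ≤ K * toeplitzTail r n * (2 * Real.pi) := by
    intro n
    have hec : ∀ i, Continuous fun ω => fourierVec n ω i := fun i => by
      unfold fourierVec; fun_prop
    have hmc : ∀ i, Continuous fun ω =>
        ((toeplitz r n ^ k).map Complex.ofReal *ᵥ fourierVec n ω) i := fun i => by
      unfold mulVec dotProduct; fun_prop
    have heq : ((2 * Real.pi * (toeplitz r n ^ k).trace
        - n * ∫ ω in (0 : ℝ)..(2 * Real.pi), f ω ^ k : ℝ) : ℂ)
        = ∫ ω in (0 : ℝ)..(2 * Real.pi), ∑ i, (starRingEnd ℂ) (fourierVec n ω i) *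
          (((toeplitz r n ^ k).map Complex.ofReal *ᵥ fourierVec n ω) i
            - (f ω : ℂ) ^ k * fourierVec n ω i) := by
      have h1 : ∀ ω, ∑ i, (starRingEnd ℂ) (fourierVec n ω i) *
          (((toeplitz r n ^ k).map Complex.ofReal *ᵥ fourierVec n ω) i
            - (f ω : ℂ) ^ k * fourierVec n ω i)
          = ∑ i, (starRingEnd ℂ) (fourierVec n ω i) *
            ((toeplitz r n ^ k).map Complex.ofReal *ᵥ fourierVec n ω) i
            - n * ((f ω ^ k : ℝ) : ℂ) := by
        intro ω
        simp_rw [mul_sub, Finset.sum_sub_distrib, mul_left_comm, Complex.conj_mul',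
          norm_fourierVec]
        simp
      simp_rw [h1]
      rw [intervalIntegral.integral_sub, integral_fourierVec_quadratic,
        intervalIntegral.integral_const_mul, intervalIntegral.integral_ofReal]
      · push_cast; rfl
      · exact Continuous.intervalIntegrable (continuous_finsetSum _ fun i _ =>
          (Complex.continuous_conj.comp (hec i)).mul (hmc i)) _ _
      · exact Continuous.intervalIntegrable (by fun_prop) _ _
    rw [← Real.norm_eq_abs, ← Complex.norm_real, heq]
    refine (intervalIntegral.norm_integral_le_of_norm_le_const
      (C := K * toeplitzTail r n) fun ω _ => ?_).trans_eq ?_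
    · refine (norm_sum_le _ _).trans ((Finset.sum_le_sum fun i _ => ?_).trans (hK n ω))
      rw [norm_mul, RCLike.norm_conj, norm_fourierVec, one_mul]
    · rw [sub_zero, abs_of_pos (by positivity)]
  have hlim := (tendsto_toeplitzTail_div hsum).const_mul K
  rw [mul_zero] at hlim
  rw [tendsto_iff_norm_sub_tendsto_zero]
  refine squeeze_zero' (Eventually.of_forall fun n => norm_nonneg _) ?_ hlim
  filter_upwards [eventually_gt_atTop 0] with n hn
  have hn' : (0 : ℝ) < n := by exact_mod_cast hn
  have : (toeplitz r n ^ k).trace / n - (2 * Real.pi)⁻¹ * ∫ ω in (0 : ℝ)..(2 * Real.pi), f ω ^ k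
      = (2 * Real.pi * (toeplitz r n ^ k).trace
      - n * ∫ ω in (0 : ℝ)..(2 * Real.pi), f ω ^ k) / (2 * Real.pi * n) := by
    field_simp
  rw [this, Real.norm_eq_abs, abs_div, abs_of_pos (show 0 < 2 * Real.pi * n by positivity),
    div_le_iff₀ (by positivity)]
  refine (hbound n).trans_eq ?_
  field_simp

lemma eigenvalues_toeplitz_mem_Icc (hsum : Summable fun k => |r k|)
    (hf : ∀ ω : ℝ, (f ω : ℂ) = ∑' k : ℤ, (r k : ℂ) * Complex.exp (-Complex.I * k * ω))
    {M : ℝ} (hM : ∀ ω, f ω ≤ M) {n : ℕ} (hS : (toeplitz r n).PosSemidef) (i : Fin n) :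
    hS.1.eigenvalues i ∈ Set.Icc 0 M := by
  refine ⟨hS.eigenvalues_nonneg i, ?_⟩
  set v := hS.1.eigenvectorBasis i
  have hv : v.ofLp ⬝ᵥ v.ofLp = 1 := by
    have := orthonormal_iff_ite.mp hS.1.eigenvectorBasis.orthonormal i i
    rw [EuclideanSpace.inner_eq_star_dotProduct] at this
    simpa using this
  have h := toeplitz_quadratic_le hsum hf hM v.ofLp
  rw [hS.1.mulVec_eigenvectorBasis, dotProduct_smul, hv] at h
  simpa using h

/-- **Szegő's limit theorem** for Toeplitz matrices with absolutely summable symbol. -/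
lemma tendsto_sum_eigenvalues_toeplitz_div (hsum : Summable fun k => |r k|)
    (hsymm : ∀ k, r (-k) = r k)
    (hf : ∀ ω : ℝ, (f ω : ℂ) = ∑' k : ℤ, (r k : ℂ) * Complex.exp (-Complex.I * k * ω))
    {M : ℝ} (hbound : ∀ ω, f ω ∈ Set.Icc 0 M) (hS : ∀ n, (toeplitz r n).PosSemidef)
    {g : ℝ → ℝ} (hg : ContinuousOn g (Set.Icc 0 M)) :
    Tendsto (fun n : ℕ => (∑ i, g ((hS n).1.eigenvalues i)) / n) atTop
      (𝓝 ((2 * Real.pi)⁻¹ * ∫ ω in (0 : ℝ)..(2 * Real.pi), g (f ω))) := by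
  have hfc := continuous_of_summable_fourier hsum hf
  have hpoly : ∀ p : Polynomial ℝ,
      Tendsto (fun n : ℕ => (∑ i, p.eval ((hS n).1.eigenvalues i)) / n) atTop
        (𝓝 ((2 * Real.pi)⁻¹ * ∫ ω in (0 : ℝ)..(2 * Real.pi), p.eval (f ω))) := by
    intro p
    induction p using Polynomial.induction_on' with
    | add p q hp hq =>
      simp_rw [Polynomial.eval_add, Finset.sum_add_distrib, add_div]
      rw [intervalIntegral.integral_add (Continuous.intervalIntegrable (by fun_prop) _ _)
        (Continuous.intervalIntegrable (by fun_prop) _ _), mul_add]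
      exact hp.add hq
    | monomial k a =>
      simp_rw [Polynomial.eval_monomial, ← Finset.mul_sum, ← trace_pow_eq_sum_eigenvalues,
        mul_div_assoc, intervalIntegral.integral_const_mul, mul_left_comm _ a]
      exact (tendsto_trace_toeplitz_pow_div hsum hsymm hf k).const_mul a
  rw [Metric.tendsto_atTop]
  intro ε hε
  obtain ⟨p, hp⟩ := exists_polynomial_near_of_continuousOn 0 M g hg (ε / 3) (by positivity)
  obtain ⟨N, hN⟩ := Metric.tendsto_atTop.mp (hpoly p) (ε / 3) (by positivity)
  refine ⟨N, fun n hn => ?_⟩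
  have h1 := hN n hn
  have h2 : |(∑ i, p.eval ((hS n).1.eigenvalues i)) / n - (∑ i, g ((hS n).1.eigenvalues i)) / n|
      ≤ ε / 3 := by
    rw [← sub_div, ← Finset.sum_sub_distrib, abs_div, Nat.abs_cast]
    refine div_le_of_le_mul₀ n.cast_nonneg (by positivity) ?_
    refine (Finset.abs_sum_le_sum_abs _ _).trans ((Finset.sum_le_sum fun i _ =>
      (hp _ (eigenvalues_toeplitz_mem_Icc hsum hf (fun ω => (hbound ω).2) (hS n) i)).le).trans ?_)
    simp [mul_comm]
  have hgf : IntervalIntegrable (fun ω => g (f ω)) volume 0 (2 * Real.pi) :=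
    (hg.comp_continuous hfc hbound).intervalIntegrable _ _
  have hpf : IntervalIntegrable (fun ω => p.eval (f ω)) volume 0 (2 * Real.pi) :=
    Continuous.intervalIntegrable (by fun_prop) _ _
  have h3 : |(2 * Real.pi)⁻¹ * (∫ ω in (0 : ℝ)..(2 * Real.pi), p.eval (f ω))
      - (2 * Real.pi)⁻¹ * ∫ ω in (0 : ℝ)..(2 * Real.pi), g (f ω)| ≤ ε / 3 := by
    rw [← mul_sub, ← intervalIntegral.integral_sub hpf hgf, abs_mul,
      abs_of_pos (by positivity), inv_mul_le_iff₀ (by positivity)]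
    refine (intervalIntegral.norm_integral_le_of_norm_le_const
      (f := fun ω => p.eval (f ω) - g (f ω)) (C := ε / 3)
      fun ω _ => (hp _ (hbound ω)).le).trans_eq ?_
    rw [sub_zero, abs_of_pos (by positivity), mul_comm]
  rw [Real.dist_eq] at h1 ⊢
  rw [abs_lt] at h1 ⊢
  rw [abs_le] at h2 h3
  constructor <;> linarith [h1.1, h1.2, h2.1, h2.2, h3.1, h3.2]

lemma one_sub_mul_pos_of_mem_Icc {c M : ℝ} (hc : c * M < 1) {x : ℝ} (hx : x ∈ Set.Icc 0 M) :
    0 < 1 - c * x := by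
  rcases le_total 0 c with h | h
  · linarith [mul_le_mul_of_nonneg_left hx.2 h]
  · linarith [mul_nonpos_of_nonpos_of_nonneg h hx.1]

lemma det_one_sub_smul_toeplitz_pos (hsum : Summable fun k => |r k|)
    (hf : ∀ ω : ℝ, (f ω : ℂ) = ∑' k : ℤ, (r k : ℂ) * Complex.exp (-Complex.I * k * ω))
    {M : ℝ} (hM : ∀ ω, f ω ≤ M) {n : ℕ} (hS : (toeplitz r n).PosSemidef)
    {c : ℝ} (hc : c * M < 1) : 0 < (1 - c • toeplitz r n).det := by
  rw [det_one_sub_smul_eq_prod_eigenvalues hS.1]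
  exact Finset.prod_pos fun i _ =>
    one_sub_mul_pos_of_mem_Icc hc (eigenvalues_toeplitz_mem_Icc hsum hf hM hS i)

lemma tendsto_log_det_one_sub_smul_toeplitz_div (hsum : Summable fun k => |r k|)
    (hsymm : ∀ k, r (-k) = r k)
    (hf : ∀ ω : ℝ, (f ω : ℂ) = ∑' k : ℤ, (r k : ℂ) * Complex.exp (-Complex.I * k * ω))
    {M : ℝ} (hbound : ∀ ω, f ω ∈ Set.Icc 0 M) (hS : ∀ n, (toeplitz r n).PosSemidef)
    {c : ℝ} (hc : c * M < 1) :
    Tendsto (fun n : ℕ => Real.log (1 - c • toeplitz r n).det / n) atTop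
      (𝓝 ((2 * Real.pi)⁻¹ * ∫ ω in (0 : ℝ)..(2 * Real.pi), Real.log (1 - c * f ω))) := by
  have hpos : ∀ x ∈ Set.Icc 0 M, 1 - c * x ≠ 0 := fun x hx =>
    (one_sub_mul_pos_of_mem_Icc hc hx).ne'
  refine (tendsto_sum_eigenvalues_toeplitz_div hsum hsymm hf hbound hS
    (g := fun x => Real.log (1 - c * x)) (ContinuousOn.log (by fun_prop) hpos)).congr fun n => ?_
  rw [det_one_sub_smul_eq_prod_eigenvalues (hS n).1, Real.log_prod fun i _ => hpos _
    (eigenvalues_toeplitz_mem_Icc hsum hf (fun ω => (hbound ω).2) (hS n) i)]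

end Toeplitz

section QuadraticForm

variable {ι : Type*} [Fintype ι] [DecidableEq ι]

/-- If `t Q A Aᵀ = P` and the quadratic form of `P` is at most `κ < 1`, then the eigenvalues of
`t Aᵀ Q A` are smaller than `1`. -/
lemma eigenvalues_smul_transpose_mul_mul_lt_one {A Q P : Matrix ι ι ℝ} {t κ : ℝ} (hκ : κ < 1)
    (hQ : t • (Q * (A * Aᵀ)) = P) (hP : ∀ w : ι → ℝ, w ⬝ᵥ P *ᵥ w ≤ κ * (w ⬝ᵥ w))
    (hG : (t • (Aᵀ * Q * A)).IsHermitian) (i : ι) : hG.eigenvalues i < 1 := by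
  set d := hG.eigenvalues i
  set v : ι → ℝ := (hG.eigenvectorBasis i).ofLp
  have hv : v ≠ 0 := fun h =>
    hG.eigenvectorBasis.orthonormal.ne_zero i (by ext j; exact congrFun h j)
  have hGv : (t • (Aᵀ * Q * A)) *ᵥ v = d • v := hG.mulVec_eigenvectorBasis i
  set w := (Q * A) *ᵥ v with hw
  have hGw : t • (Aᵀ *ᵥ w) = d • v := by
    rw [← hGv, hw, mulVec_mulVec, smul_mulVec, mul_assoc]
  by_cases hw0 : w = 0
  · rw [hw0, mulVec_zero, smul_zero, eq_comm, smul_eq_zero] at hGw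
    rw [hGw.resolve_right hv]
    exact one_pos
  · have hPw : P *ᵥ w = d • w := by
      rw [← hQ, smul_mulVec, ← mul_assoc, ← mulVec_mulVec, ← mulVec_smul, hGw, mulVec_smul]
    have h := hP w
    rw [hPw, dotProduct_smul, smul_eq_mul] at h
    have hww : 0 < w ⬝ᵥ w := lt_of_le_of_ne
      (Finset.sum_nonneg fun _ _ => mul_self_nonneg _) (Ne.symm (mt dotProduct_self_eq_zero.mp hw0))
    exact (le_of_mul_le_mul_right h hww).trans_lt hκ

end QuadraticForm

/-- limiting normalized cumulant generating function of the optimal detector's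
statistic under `H₁`.  Let `σ, θ > 0`, let `r : ℤ → ℝ` be a symmetric absolutely summable
unit-variance autocovariance (`r 0 = 1`) with spectral density `f_s(ω) = ∑_k r(k) e^{-ikω}`,
`0 ≤ f_s ≤ M`, and positive semidefinite Toeplitz matrices `Σ_{s,n} = (r(i-j))`.  With
`Qₙ = σ⁻² I - (σ² I + θ² Σ_{s,n})⁻¹`,
`T_{o,n}(y) = (1/n) [(1/2) log (det(σ² I)/det(σ² I + θ² Σ_{s,n})) + (1/2) yᵀ Qₙ y]`, and
`yₙ ~ N(0, σ² I + θ² Σ_{s,n})` (realized as the law of `Aₙ ⬝ Z` with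
`Aₙ Aₙᵀ = σ² I + θ² Σ_{s,n}`, `Z` standard Gaussian), for every real `t` with `t θ² M/σ² < 1`,
`(1/n) log E[exp (n t T_{o,n}(yₙ))] →
  (t/4π) ∫₀^{2π} log (σ²/(σ²+θ² f_s(ω))) dω - (1/4π) ∫₀^{2π} log (1 - t θ² f_s(ω)/σ²) dω`. -/
theorem optimal_detector_cgf_H1
    (σ θ : ℝ) (hσ : 0 < σ) (hθ : 0 < θ)
    (r : ℤ → ℝ) (hr0 : r 0 = 1) (hsymm : ∀ k, r (-k) = r k) (hsum : Summable fun k => |r k|)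
    (f : ℝ → ℝ)
    (hf : ∀ ω : ℝ, (f ω : ℂ) = ∑' k : ℤ, (r k : ℂ) * Complex.exp (-Complex.I * k * ω))
    (M : ℝ) (hbound : ∀ ω : ℝ, 0 ≤ f ω ∧ f ω ≤ M)
    (hpsd : ∀ n : ℕ, (Matrix.of fun i j : Fin n => r ((i.val : ℤ) - (j.val : ℤ))).PosSemidef)
    (Q : (n : ℕ) → Matrix (Fin n) (Fin n) ℝ)
    (hQ : ∀ n : ℕ, Q n = (σ ^ 2)⁻¹ • (1 : Matrix (Fin n) (Fin n) ℝ)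
        - (σ ^ 2 • (1 : Matrix (Fin n) (Fin n) ℝ)
            + θ ^ 2 • Matrix.of fun i j : Fin n => r ((i.val : ℤ) - (j.val : ℤ)))⁻¹)
    (T : (n : ℕ) → (Fin n → ℝ) → ℝ)
    (hT : ∀ (n : ℕ) (y : Fin n → ℝ),
        T n y = (1 / (n : ℝ)) * ((1 / 2) * Real.log
            ((σ ^ 2 • (1 : Matrix (Fin n) (Fin n) ℝ)).det
              / (σ ^ 2 • (1 : Matrix (Fin n) (Fin n) ℝ)
                  + θ ^ 2 • Matrix.of fun i j : Fin n => r ((i.val : ℤ) - (j.val : ℤ))).det)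
          + (1 / 2) * (y ⬝ᵥ (Q n).mulVec y)))
    (A : (n : ℕ) → Matrix (Fin n) (Fin n) ℝ)
    (hA : ∀ n : ℕ, A n * (A n)ᵀ
        = σ ^ 2 • (1 : Matrix (Fin n) (Fin n) ℝ)
          + θ ^ 2 • Matrix.of fun i j : Fin n => r ((i.val : ℤ) - (j.val : ℤ)))
    (t : ℝ) (ht : t * θ ^ 2 * M / σ ^ 2 < 1) :
    Tendsto (fun n : ℕ => (1 / (n : ℝ)) * Real.log (∫ y, Real.exp ((n : ℝ) * t * T n y)
        ∂(Measure.map (A n).mulVec (Measure.pi fun _ : Fin n => gaussianReal 0 1)))) atTop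
      (𝓝 ((t / (4 * Real.pi)) * (∫ ω in (0 : ℝ)..(2 * Real.pi),
            Real.log (σ ^ 2 / (σ ^ 2 + θ ^ 2 * f ω)))
        - (1 / (4 * Real.pi)) * ∫ ω in (0 : ℝ)..(2 * Real.pi),
            Real.log (1 - t * θ ^ 2 * f ω / σ ^ 2))) := by
  have hσ2 : σ ^ 2 ≠ 0 := by positivity
  have hM0 : 0 ≤ M := (hbound 0).1.trans (hbound 0).2
  have hfM : ∀ ω, f ω ≤ M := fun ω => (hbound ω).2
  set c : ℝ := t * θ ^ 2 / σ ^ 2 with hc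
  set c₀ : ℝ := -(θ ^ 2 / σ ^ 2) with hc₀
  have hcM : c * M < 1 := by
    rw [hc, div_mul_eq_mul_div]; exact ht
  have hc₀M : c₀ * M < 1 := by
    have : 0 ≤ θ ^ 2 / σ ^ 2 * M := by positivity
    rw [hc₀]; linarith
  have hB : ∀ n, σ ^ 2 • (1 : Matrix (Fin n) (Fin n) ℝ) + θ ^ 2 • toeplitz r n
      = σ ^ 2 • (1 - c₀ • toeplitz r n) := by
    intro n
    rw [smul_sub, smul_smul, hc₀, mul_neg, mul_div_cancel₀ _ hσ2, neg_smul, sub_neg_eq_add]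
  have hdet₀ : ∀ n, 0 < (1 - c₀ • toeplitz r n).det := fun n =>
    det_one_sub_smul_toeplitz_pos hsum hf hfM (hpsd n) hc₀M
  have hdet : ∀ n, 0 < (1 - c • toeplitz r n).det := fun n =>
    det_one_sub_smul_toeplitz_pos hsum hf hfM (hpsd n) hcM
  have hlogdet : ∀ n, Real.log ((σ ^ 2 • (1 : Matrix (Fin n) (Fin n) ℝ)).det
      / (σ ^ 2 • (1 : Matrix (Fin n) (Fin n) ℝ) + θ ^ 2 • toeplitz r n).det)
      = -Real.log (1 - c₀ • toeplitz r n).det := by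
    intro n
    rw [hB, det_smul, det_smul, det_one, mul_one, div_mul_cancel_left₀ (pow_ne_zero _ hσ2),
      Real.log_inv]
  have hQB : ∀ n, t • (Q n * (A n * (A n)ᵀ)) = c • toeplitz r n := by
    intro n
    have hu : IsUnit (A n * (A n)ᵀ).det := by
      rw [hA n, hB, det_smul]
      exact (mul_ne_zero (pow_ne_zero _ hσ2) (hdet₀ n).ne').isUnit
    rw [hQ n, ← hA n, sub_mul, nonsing_inv_mul _ hu, hA n, smul_mul_assoc, one_mul, smul_add,
      smul_smul, smul_smul, inv_mul_cancel₀ hσ2, one_smul, add_sub_cancel_left, smul_smul, hc]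
    congr 1
    ring
  have hG : ∀ n, (t • ((A n)ᵀ * Q n * A n)).IsHermitian := by
    intro n
    have hQh : (Q n).IsHermitian := by
      rw [hQ n, ← hA n]
      exact (isHermitian_one.smul (IsSelfAdjoint.all _)).sub
        (isHermitian_mul_conjTranspose_self (A n)).inv
    exact (isHermitian_conjTranspose_mul_mul (A n) hQh).smul (IsSelfAdjoint.all _)
  have hquad : ∀ n (w : Fin n → ℝ), w ⬝ᵥ (c • toeplitz r n) *ᵥ w ≤ max 0 (c * M) * (w ⬝ᵥ w) := by
    intro n w
    have hww : 0 ≤ w ⬝ᵥ w := Finset.sum_nonneg fun _ _ => mul_self_nonneg _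
    rw [smul_mulVec, dotProduct_smul, smul_eq_mul]
    rcases le_total 0 c with h | h
    · calc _ ≤ c * (M * (w ⬝ᵥ w)) :=
            mul_le_mul_of_nonneg_left (toeplitz_quadratic_le hsum hf hfM w) h
        _ = c * M * (w ⬝ᵥ w) := by ring
        _ ≤ _ := mul_le_mul_of_nonneg_right (le_max_right _ _) hww
    · exact (mul_nonpos_of_nonpos_of_nonneg h ((hpsd n).dotProduct_mulVec_nonneg w)).trans
        (mul_nonneg (le_max_left _ _) hww)
  have hcgf : ∀ n : ℕ, 0 < n → (1 / (n : ℝ)) * Real.log (∫ y, Real.exp ((n : ℝ) * t * T n y)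
      ∂(Measure.map (A n).mulVec (Measure.pi fun _ : Fin n => gaussianReal 0 1)))
      = -(t / 2) * (Real.log (1 - c₀ • toeplitz r n).det / n)
        - 1 / 2 * (Real.log (1 - c • toeplitz r n).det / n) := by
    intro n hn
    have hn' : (n : ℝ) ≠ 0 := by exact_mod_cast hn.ne'
    have hexp : ∀ y : Fin n → ℝ, Real.exp ((n : ℝ) * t * T n y)
        = Real.exp (-(t / 2) * Real.log (1 - c₀ • toeplitz r n).det)
          * Real.exp (t / 2 * (y ⬝ᵥ Q n *ᵥ y)) := by
      intro y
      rw [hT, hlogdet, ← Real.exp_add]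
      congr 1
      field_simp
    have hz : ∀ z : Fin n → ℝ, t / 2 * ((A n *ᵥ z) ⬝ᵥ Q n *ᵥ (A n *ᵥ z))
        = 1 / 2 * (z ⬝ᵥ (t • ((A n)ᵀ * Q n * A n)) *ᵥ z) := by
      intro z
      rw [smul_mulVec, dotProduct_smul, ← mulVec_mulVec, ← mulVec_mulVec, dotProduct_mulVec z,
        vecMul_transpose, smul_eq_mul]
      ring
    have hdetG : (1 - t • ((A n)ᵀ * Q n * A n)).det = (1 - c • toeplitz r n).det := by
      rw [← hQB n, mul_assoc, ← Matrix.mul_smul, det_one_sub_mul_comm, smul_mul_assoc, mul_assoc]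
    rw [integral_map (Continuous.aemeasurable (by fun_prop))
      (by simp_rw [hexp]; exact Continuous.aestronglyMeasurable (by fun_prop))]
    simp_rw [hexp, hz]
    rw [integral_const_mul, integral_exp_half_quadratic_pi_gaussianReal (hG n)
      (eigenvalues_smul_transpose_mul_mul_lt_one (max_lt one_pos hcM) (hQB n) (hquad n) (hG n)),
      hdetG, Real.log_mul (Real.exp_pos _).ne' (inv_ne_zero (Real.sqrt_pos.mpr (hdet n)).ne'),
      Real.log_exp, Real.log_inv, Real.log_sqrt (hdet n).le]
    field_simp
    ring
  have hlim := ((tendsto_log_det_one_sub_smul_toeplitz_div hsum hsymm hf hbound hpsd hc₀M).const_mul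
    (-(t / 2))).sub ((tendsto_log_det_one_sub_smul_toeplitz_div hsum hsymm hf hbound hpsd
      hcM).const_mul (1 / 2))
  have hint₀ : ∀ ω, Real.log (σ ^ 2 / (σ ^ 2 + θ ^ 2 * f ω)) = -Real.log (1 - c₀ * f ω) := by
    intro ω
    have h1 : 0 < σ ^ 2 + θ ^ 2 * f ω := by
      have := (hbound ω).1
      positivity
    rw [← Real.log_inv, hc₀]
    congr 1
    have h2 : 1 - -(θ ^ 2 / σ ^ 2) * f ω = (σ ^ 2 + θ ^ 2 * f ω) / σ ^ 2 := by
      field_simp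
      ring
    rw [h2, inv_div]
  have hint : ∀ ω, Real.log (1 - t * θ ^ 2 * f ω / σ ^ 2) = Real.log (1 - c * f ω) := by
    intro ω
    rw [hc, div_mul_eq_mul_div]
  simp_rw [hint₀, hint, intervalIntegral.integral_neg]
  have hval : ∀ a b : ℝ, -(t / 2) * ((2 * Real.pi)⁻¹ * a) - 1 / 2 * ((2 * Real.pi)⁻¹ * b)
      = t / (4 * Real.pi) * -a - 1 / (4 * Real.pi) * b := by
    intro a b
    have := Real.pi_ne_zero
    field_simp
    ring
  rw [hval] at hlim
  refine hlim.congr' ?_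
  filter_upwards [eventually_gt_atTop 0] with n hn
  exact (hcgf n hn).symm
end

section
/- Let σ > 0, θ > 0, and let f_s : [0, 2π] → ℝ be a bounded measurable function with 0 ≤ f_s(ω) ≤ M. Define Λ₀(t) = (t/4π)∫₀^{2π} log(σ²/(σ²+θ²f_s(ω))) dω − (1/4π)∫₀^{2π} log(1 − t·θ²f_s(ω)/(σ²+θ²f_s(ω))) dω and Λ₁(t) = (t/4π)∫₀^{2π} log(σ²/(σ²+θ²f_s(ω))) dω − (1/4π)∫₀^{2π} log(1 − t·θ²f_s(ω)/σ²) dω. Then for every real t with t·θ²M/σ² < 1 one has Λ₁(t) = Λ₀(t+1); consequently sup{−Λ₀(t) : t real, (t−1)·θ²M/σ² < 1} = sup{−Λ₁(t) : t real, t·θ²M/σ² < 1}, i.e. the error exponents of the false-alarm and miss probabilities of the optimal detector with zero threshold coincide. -/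
open MeasureTheory

theorem intervalIntegrable_log_of_mem_Icc {g : ℝ → ℝ} {a b c d : ℝ} (hg : Measurable g)
    (hab : a ≤ b) (hc : 0 < c) (h : ∀ x ∈ Set.Icc a b, g x ∈ Set.Icc c d) :
    IntervalIntegrable (fun x => Real.log (g x)) volume a b := by
  rw [intervalIntegrable_iff_integrableOn_Icc_of_le hab]
  refine Measure.integrableOn_of_bounded (M := max |Real.log c| |Real.log d|) (by simp)
    (Real.measurable_log.comp hg).aestronglyMeasurable ?_
  filter_upwards [ae_restrict_mem measurableSet_Icc] with x hx
  obtain ⟨h₁, h₂⟩ := h x hx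
  exact abs_le_max_abs_abs (Real.log_le_log hc h₁) (Real.log_le_log (hc.trans_le h₁) h₂)

theorem log_one_sub_succ_mul_div {s y t : ℝ} (hs : 0 < s) (hy : 0 ≤ y) (ht : t * y / s < 1) :
    Real.log (1 - (t + 1) * y / (s + y)) = Real.log (s / (s + y)) + Real.log (1 - t * y / s) := by
  have hsy : 0 < s + y := by positivity
  rw [← Real.log_mul (by positivity) (sub_pos.2 ht).ne']
  congr 1
  field_simp
  ring

/-- with `Λ₀` and `Λ₁` the limiting normalized cumulant generating functions of
the optimal detector's statistic under `H₀` and `H₁` for a bounded measurable spectral density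
`0 ≤ f_s ≤ M` on `[0, 2π]`, one has `Λ₁(t) = Λ₀(t+1)` whenever `t θ² M/σ² < 1`; consequently
`sup {-Λ₀(t) : (t-1) θ² M/σ² < 1} = sup {-Λ₁(t) : t θ² M/σ² < 1}`, i.e. the error exponents of
the false-alarm and miss probabilities of the optimal detector with zero threshold coincide. -/
theorem optimal_detector_exponents_coincide
    (σ θ M : ℝ) (hσ : 0 < σ) (hθ : 0 < θ)
    (f : ℝ → ℝ) (hmeas : Measurable f)
    (hbound : ∀ ω ∈ Set.Icc (0 : ℝ) (2 * Real.pi), 0 ≤ f ω ∧ f ω ≤ M)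
    (Λ₀ Λ₁ : ℝ → ℝ)
    (hΛ₀ : ∀ t : ℝ, (t - 1) * θ ^ 2 * M / σ ^ 2 < 1 →
        Λ₀ t = (t / (4 * Real.pi)) * (∫ ω in (0 : ℝ)..(2 * Real.pi),
            Real.log (σ ^ 2 / (σ ^ 2 + θ ^ 2 * f ω)))
          - (1 / (4 * Real.pi)) * ∫ ω in (0 : ℝ)..(2 * Real.pi),
            Real.log (1 - t * θ ^ 2 * f ω / (σ ^ 2 + θ ^ 2 * f ω)))
    (hΛ₁ : ∀ t : ℝ, t * θ ^ 2 * M / σ ^ 2 < 1 →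
        Λ₁ t = (t / (4 * Real.pi)) * (∫ ω in (0 : ℝ)..(2 * Real.pi),
            Real.log (σ ^ 2 / (σ ^ 2 + θ ^ 2 * f ω)))
          - (1 / (4 * Real.pi)) * ∫ ω in (0 : ℝ)..(2 * Real.pi),
            Real.log (1 - t * θ ^ 2 * f ω / σ ^ 2)) :
    (∀ t : ℝ, t * θ ^ 2 * M / σ ^ 2 < 1 → Λ₁ t = Λ₀ (t + 1)) ∧
    sSup {x : ℝ | ∃ t : ℝ, (t - 1) * θ ^ 2 * M / σ ^ 2 < 1 ∧ x = -Λ₀ t}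
      = sSup {x : ℝ | ∃ t : ℝ, t * θ ^ 2 * M / σ ^ 2 < 1 ∧ x = -Λ₁ t} := by
  have hπ : (0 : ℝ) ≤ 2 * Real.pi := by positivity
  have hσ2 : 0 < σ ^ 2 := by positivity
  have hM : 0 ≤ M := by
    obtain ⟨h₁, h₂⟩ := hbound 0 ⟨le_rfl, hπ⟩
    exact h₁.trans h₂
  have key : ∀ t : ℝ, t * θ ^ 2 * M / σ ^ 2 < 1 → Λ₁ t = Λ₀ (t + 1) := by
    intro t ht
    have hlow : ∀ ω ∈ Set.Icc (0 : ℝ) (2 * Real.pi),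
        t * θ ^ 2 * f ω / σ ^ 2 ∈
          Set.Icc (min 0 (t * θ ^ 2 * M / σ ^ 2)) (max 0 (t * θ ^ 2 * M / σ ^ 2)) := by
      intro ω hω
      obtain ⟨h₀, h₁⟩ := hbound ω hω
      rcases le_total 0 t with h | h
      · exact ⟨min_le_of_left_le (by positivity), le_max_of_le_right (by gcongr)⟩
      · have hc : t * θ ^ 2 ≤ 0 := mul_nonpos_of_nonpos_of_nonneg h (by positivity)
        refine ⟨min_le_of_right_le ?_, le_max_of_le_left ?_⟩
        · exact div_le_div_of_nonneg_right (mul_le_mul_of_nonpos_left h₁ hc) hσ2.le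
        · exact div_nonpos_of_nonpos_of_nonneg (mul_nonpos_of_nonpos_of_nonneg hc h₀) hσ2.le
    have hmax : max 0 (t * θ ^ 2 * M / σ ^ 2) < 1 := max_lt one_pos ht
    have hint₀ : IntervalIntegrable (fun ω => Real.log (σ ^ 2 / (σ ^ 2 + θ ^ 2 * f ω)))
        volume 0 (2 * Real.pi) := by
      refine intervalIntegrable_log_of_mem_Icc (c := σ ^ 2 / (σ ^ 2 + θ ^ 2 * M)) (d := 1)
        (by fun_prop) hπ (by positivity) fun ω hω => ?_
      obtain ⟨h₀, h₁⟩ := hbound ω hω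
      refine ⟨by gcongr, div_le_one_of_le₀ ?_ (by positivity)⟩
      exact le_add_of_nonneg_right (by positivity)
    have hint₁ : IntervalIntegrable (fun ω => Real.log (1 - t * θ ^ 2 * f ω / σ ^ 2))
        volume 0 (2 * Real.pi) :=
      intervalIntegrable_log_of_mem_Icc (by fun_prop) hπ (sub_pos.2 hmax) fun ω hω =>
        ⟨sub_le_sub_left (hlow ω hω).2 1, sub_le_sub_left (hlow ω hω).1 1⟩
    have hsplit : (∫ ω in (0 : ℝ)..(2 * Real.pi),
          Real.log (1 - (t + 1) * θ ^ 2 * f ω / (σ ^ 2 + θ ^ 2 * f ω)))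
        = (∫ ω in (0 : ℝ)..(2 * Real.pi), Real.log (σ ^ 2 / (σ ^ 2 + θ ^ 2 * f ω)))
          + ∫ ω in (0 : ℝ)..(2 * Real.pi), Real.log (1 - t * θ ^ 2 * f ω / σ ^ 2) := by
      rw [← intervalIntegral.integral_add hint₀ hint₁]
      refine intervalIntegral.integral_congr fun ω hω => ?_
      rw [Set.uIcc_of_le hπ] at hω
      have hlt := (hlow ω hω).2.trans_lt hmax
      simp only [mul_assoc] at hlt ⊢
      exact log_one_sub_succ_mul_div hσ2 (mul_nonneg (by positivity) (hbound ω hω).1) hlt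
    rw [hΛ₁ t ht, hΛ₀ (t + 1) (by simpa using ht), hsplit]
    ring
  refine ⟨key, congrArg sSup (Set.ext fun x => ⟨?_, ?_⟩)⟩
  · rintro ⟨t, ht, rfl⟩
    exact ⟨t - 1, ht, by rw [key _ ht, sub_add_cancel]⟩
  · rintro ⟨t, ht, rfl⟩
    exact ⟨t + 1, by simpa using ht, by rw [key t ht]⟩
end

section
/- Let σ > 0 and let f : [0, 2π] → ℝ be measurable with 0 < f(ω) ≤ K for almost every ω, such that log∘f is integrable with ∫₀^{2π} log f(ω) dω = 0. Then lim_{θ→∞} [ (1/2π)·∫₀^{2π} log(σ² + θ²·f(ω)) dω − log θ² ] = 0; equivalently, (1/4π)∫₀^{2π} log(σ²/(σ²+θ²f(ω))) dω − (1/2)·log(σ²/θ²) → 0 as θ → ∞. -/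
open MeasureTheory Filter Topology

section LogShift

variable {α : Type*} {m : MeasurableSpace α} {μ : Measure α} {f : α → ℝ} {K : ℝ}

theorem abs_log_add_le {x c : ℝ} (hx : 0 < x) (hxK : x ≤ K) (hc : 0 ≤ c) (hc1 : c ≤ 1) :
    |Real.log (c + x)| ≤ |Real.log x| + |Real.log (1 + K)| := by
  have h1 : Real.log x ≤ Real.log (c + x) := Real.log_le_log hx (by linarith)
  have h2 : Real.log (c + x) ≤ Real.log (1 + K) := Real.log_le_log (by linarith) (by linarith)
  rw [abs_le]
  constructor
  · linarith [neg_abs_le (Real.log x), abs_nonneg (Real.log (1 + K))]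
  · linarith [le_abs_self (Real.log (1 + K)), abs_nonneg (Real.log x)]

theorem integrable_log_add [IsFiniteMeasure μ] (hf : Measurable f)
    (hae : ∀ᵐ ω ∂μ, 0 < f ω ∧ f ω ≤ K) (hint : Integrable (fun ω => Real.log (f ω)) μ)
    {c : ℝ} (hc : 0 ≤ c) (hc1 : c ≤ 1) : Integrable (fun ω => Real.log (c + f ω)) μ := by
  refine (hint.abs.add (integrable_const |Real.log (1 + K)|)).mono'
    (Real.measurable_log.comp (hf.const_add c)).aestronglyMeasurable ?_
  filter_upwards [hae] with ω hω
  exact abs_log_add_le hω.1 hω.2 hc hc1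

theorem tendsto_integral_log_add [IsFiniteMeasure μ] (hf : Measurable f)
    (hae : ∀ᵐ ω ∂μ, 0 < f ω ∧ f ω ≤ K) (hint : Integrable (fun ω => Real.log (f ω)) μ) :
    Tendsto (fun c : ℝ => ∫ ω, Real.log (c + f ω) ∂μ) (𝓝[≥] 0)
      (𝓝 (∫ ω, Real.log (f ω) ∂μ)) := by
  refine tendsto_integral_filter_of_dominated_convergence
    (fun ω => |Real.log (f ω)| + |Real.log (1 + K)|) ?_ ?_
    (hint.abs.add (integrable_const _)) ?_
  · exact .of_forall fun c => (Real.measurable_log.comp (hf.const_add c)).aestronglyMeasurable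
  · filter_upwards [Icc_mem_nhdsGE (zero_lt_one' ℝ)] with c hc
    filter_upwards [hae] with ω hω
    exact abs_log_add_le hω.1 hω.2 hc.1 hc.2
  · filter_upwards [hae] with ω hω
    have h : ContinuousAt (fun c : ℝ => Real.log (c + f ω)) 0 :=
      ContinuousAt.log (by fun_prop) (by simpa using hω.1.ne')
    simpa using h.tendsto.mono_left nhdsWithin_le_nhds

end LogShift

/-- let `σ > 0` and `f : [0,2π] → ℝ` be measurable with `0 < f ≤ K` a.e. and
`∫₀^{2π} log f = 0` (unit-power normalization from spectral factorization).  Then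
`(1/2π) ∫₀^{2π} log (σ² + θ² f(ω)) dω - log θ² → 0` as `θ → ∞`; equivalently
`(1/4π) ∫₀^{2π} log (σ²/(σ² + θ² f(ω))) dω - (1/2) log (σ²/θ²) → 0`. -/
theorem log_det_terms_converge_high_snr
    (σ K : ℝ) (hσ : 0 < σ)
    (f : ℝ → ℝ) (hmeas : Measurable f)
    (hae : ∀ᵐ ω ∂(volume.restrict (Set.Icc (0 : ℝ) (2 * Real.pi))), 0 < f ω ∧ f ω ≤ K)
    (hint : IntegrableOn (fun ω => Real.log (f ω)) (Set.Icc (0 : ℝ) (2 * Real.pi)))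
    (hlog : (∫ ω in (0 : ℝ)..(2 * Real.pi), Real.log (f ω)) = 0) :
    Tendsto (fun θ : ℝ =>
        (1 / (2 * Real.pi)) * (∫ ω in (0 : ℝ)..(2 * Real.pi), Real.log (σ ^ 2 + θ ^ 2 * f ω))
          - Real.log (θ ^ 2)) atTop (𝓝 0) ∧
    Tendsto (fun θ : ℝ =>
        (1 / (4 * Real.pi)) * (∫ ω in (0 : ℝ)..(2 * Real.pi),
            Real.log (σ ^ 2 / (σ ^ 2 + θ ^ 2 * f ω)))
          - (1 / 2) * Real.log (σ ^ 2 / θ ^ 2)) atTop (𝓝 0) := by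
  have hπ := Real.pi_pos
  have h2π : (0 : ℝ) ≤ 2 * Real.pi := by positivity
  set μ : Measure ℝ := volume.restrict (Set.Ioc (0 : ℝ) (2 * Real.pi)) with hμ
  have hvol : μ.real Set.univ = 2 * Real.pi := by simp [hμ, h2π]
  rw [← restrict_Ioc_eq_restrict_Icc] at hae
  rw [IntegrableOn, ← restrict_Ioc_eq_restrict_Icc] at hint
  simp only [intervalIntegral.integral_of_le h2π] at hlog ⊢
  have hc : Tendsto (fun θ : ℝ => σ ^ 2 / θ ^ 2) atTop (𝓝[≥] 0) :=
    tendsto_nhdsWithin_iff.2 ⟨tendsto_const_nhds.div_atTop (tendsto_pow_atTop two_ne_zero),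
      .of_forall fun θ => div_nonneg (sq_nonneg σ) (sq_nonneg θ)⟩
  have hlim := (tendsto_integral_log_add hmeas hae hint).comp hc
  rw [hlog] at hlim
  have hsplit {θ : ℝ} (hθ : 0 < θ) : (fun ω => Real.log (σ ^ 2 + θ ^ 2 * f ω)) =ᵐ[μ]
      fun ω => Real.log (θ ^ 2) + Real.log (σ ^ 2 / θ ^ 2 + f ω) := by
    filter_upwards [hae] with ω hω
    have := hω.1
    rw [← Real.log_mul (by positivity) (by positivity)]
    congr 1
    field_simp
  have hintc {θ : ℝ} (hθ : σ ≤ θ) : Integrable (fun ω => Real.log (σ ^ 2 / θ ^ 2 + f ω)) μ := by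
    refine integrable_log_add hmeas hae hint (by positivity) ?_
    exact div_le_one_of_le₀ (by gcongr) (sq_nonneg θ)
  have hfirst : Tendsto (fun θ : ℝ => (1 / (2 * Real.pi)) *
      (∫ ω, Real.log (σ ^ 2 + θ ^ 2 * f ω) ∂μ) - Real.log (θ ^ 2)) atTop (𝓝 0) := by
    have h := hlim.const_mul (1 / (2 * Real.pi))
    rw [mul_zero] at h
    refine h.congr' ?_
    filter_upwards [eventually_ge_atTop σ] with θ hθ
    rw [integral_congr_ae (hsplit (hσ.trans_le hθ)), integral_add (integrable_const _) (hintc hθ),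
      integral_const, hvol, smul_eq_mul, Function.comp_apply]
    field_simp
    ring
  refine ⟨hfirst, ?_⟩
  have h := hfirst.const_mul (-(1 / 2))
  rw [mul_zero] at h
  refine h.congr' ?_
  filter_upwards [eventually_ge_atTop σ] with θ hθ
  have hθ0 := hσ.trans_le hθ
  have hquot : (fun ω => Real.log (σ ^ 2 / (σ ^ 2 + θ ^ 2 * f ω))) =ᵐ[μ]
      fun ω => Real.log (σ ^ 2) - Real.log (σ ^ 2 + θ ^ 2 * f ω) := by
    filter_upwards [hae] with ω hω
    have := hω.1
    exact Real.log_div (by positivity) (by positivity)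
  have hintσ : Integrable (fun ω => Real.log (σ ^ 2 + θ ^ 2 * f ω)) μ :=
    ((integrable_const _).add (hintc hθ)).congr (hsplit hθ0).symm
  rw [integral_congr_ae hquot, integral_sub (integrable_const _) hintσ,
    integral_const, hvol, smul_eq_mul, Real.log_div (by positivity) (by positivity)]
  field_simp
  ring
end

section
/- Let σ > 0 and let f : [0, 2π] → ℝ be measurable with 0 < m ≤ f(ω) ≤ M for almost every ω, such that ∫₀^{2π} log f(ω) dω = 0. For θ > 0 define Λ₁^{sq}(t; θ) = (t/2)·log(σ²/(σ²+θ²)) − (1/4π)∫₀^{2π} log(1 − t·θ²(σ²+θ²f(ω))/(σ²(σ²+θ²))) dω and Λ₁^{opt}(t; θ) = (t/4π)∫₀^{2π} log(σ²/(σ²+θ²f(ω))) dω − (1/4π)∫₀^{2π} log(1 − t·θ²f(ω)/σ²) dω. Then for every fixed t ≤ 0, lim_{θ→∞} [Λ₁^{sq}(t; θ) − Λ₁^{opt}(t; θ)] = 0. -/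
open MeasureTheory Filter Topology

/-- The map `y ↦ log (1 + u * exp y)` is nonexpansive. -/
theorem abs_log_one_add_mul_sub_le {u x y : ℝ} (hu : 0 ≤ u) (hx : 0 < x) (hy : 0 < y) :
    |Real.log (1 + u * x) - Real.log (1 + u * y)| ≤ |Real.log x - Real.log y| := by
  wlog h : y ≤ x generalizing x y
  · rw [abs_sub_comm, abs_sub_comm (Real.log x)]
    exact this hy hx (le_of_not_ge h)
  have hux : 0 < 1 + u * x := by positivity
  have huy : 0 < 1 + u * y := by positivity
  have h1 : Real.log (1 + u * y) ≤ Real.log (1 + u * x) := Real.log_le_log huy (by gcongr)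
  have h2 : Real.log y ≤ Real.log x := Real.log_le_log hy h
  rw [abs_of_nonneg (sub_nonneg.2 h1), abs_of_nonneg (sub_nonneg.2 h2),
    ← Real.log_div hux.ne' huy.ne', ← Real.log_div hx.ne' hy.ne']
  apply Real.log_le_log (by positivity)
  rw [div_le_div_iff₀ huy hy]
  nlinarith

theorem abs_log_one_add_mul_le {u x : ℝ} (hu : 0 ≤ u) (hx : 0 < x) :
    |Real.log (1 + u * x)| ≤ |Real.log (1 + u)| + |Real.log x| := by
  have h := abs_log_one_add_mul_sub_le hu hx one_pos
  rw [mul_one, Real.log_one, sub_zero] at h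
  linarith [abs_sub_abs_le_abs_sub (Real.log (1 + u * x)) (Real.log (1 + u))]

theorem abs_log_le_of_mem_Icc {m M x : ℝ} (hm : 0 < m) (h : m ≤ x ∧ x ≤ M) :
    |Real.log x| ≤ max |Real.log m| |Real.log M| := by
  have h1 := Real.log_le_log hm h.1
  have h2 := Real.log_le_log (hm.trans_le h.1) h.2
  exact abs_le_max_abs_abs h1 h2

theorem tendsto_one_add_mul_div_one_add (x : ℝ) :
    Tendsto (fun v : ℝ => (1 + v * x) / (1 + v)) atTop (𝓝 x) := by
  have h : Tendsto (fun v : ℝ => x + (1 - x) * (1 + v)⁻¹) atTop (𝓝 (x + (1 - x) * 0)) :=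
    ((tendsto_inv_atTop_zero.comp
      (tendsto_atTop_add_const_left atTop 1 tendsto_id)).const_mul _).const_add _
  rw [mul_zero, add_zero] at h
  refine h.congr' ?_
  filter_upwards [eventually_ge_atTop 0] with v hv
  have : 1 + v ≠ 0 := by positivity
  field_simp
  ring

/-- As the signal-to-noise ratio `v` grows, the integral of the difference of the detector
integrands tends to `t ∫ log f`. -/
theorem tendsto_integral_detector_difference {α : Type*} [MeasurableSpace α] {μ : Measure α}
    [IsFiniteMeasure μ] {f : α → ℝ} {L t : ℝ} (hmeas : Measurable f) (ht : t ≤ 0)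
    (hf : ∀ᵐ ω ∂μ, 0 < f ω ∧ |Real.log (f ω)| ≤ L) :
    Tendsto (fun v : ℝ => ∫ ω, (t * (Real.log (1 + v * f ω) - Real.log (1 + v))
        - (Real.log (1 + -t * v * ((1 + v * f ω) / (1 + v)))
          - Real.log (1 + -t * v * f ω))) ∂μ) atTop (𝓝 (∫ ω, t * Real.log (f ω) ∂μ)) := by
  have key : ∀ v : ℝ, 0 ≤ v → ∀ x : ℝ, 0 < x →
      |Real.log (1 + v * x) - Real.log (1 + v)| ≤ |Real.log x| ∧
      Real.log ((1 + v * x) / (1 + v)) = Real.log (1 + v * x) - Real.log (1 + v) ∧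
      |Real.log (1 + -t * v * ((1 + v * x) / (1 + v))) - Real.log (1 + -t * v * x)|
        ≤ |Real.log ((1 + v * x) / (1 + v)) - Real.log x| := by
    intro v hv x hx
    refine ⟨?_, Real.log_div (by positivity) (by positivity), ?_⟩
    · simpa using abs_log_one_add_mul_sub_le hv hx one_pos
    · exact abs_log_one_add_mul_sub_le (mul_nonneg (by linarith) hv) (by positivity) hx
  refine tendsto_integral_filter_of_dominated_convergence (fun _ => |t| * L + (L + L)) ?_ ?_
    (integrable_const _) ?_
  · exact Eventually.of_forall fun v => Measurable.aestronglyMeasurable (by fun_prop)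
  · filter_upwards [eventually_ge_atTop 0] with v hv
    filter_upwards [hf] with ω ⟨hx, hL⟩
    obtain ⟨h1, h2, h3⟩ := key v hv _ hx
    rw [h2] at h3
    have h4 := abs_sub (Real.log (1 + v * f ω) - Real.log (1 + v)) (Real.log (f ω))
    rw [Real.norm_eq_abs]
    refine (abs_sub _ _).trans (add_le_add ?_ (by linarith))
    rw [abs_mul]
    exact mul_le_mul_of_nonneg_left (h1.trans hL) (abs_nonneg t)
  · filter_upwards [hf] with ω ⟨hx, _⟩
    have hr : Tendsto (fun v : ℝ => Real.log ((1 + v * f ω) / (1 + v))) atTop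
        (𝓝 (Real.log (f ω))) := (tendsto_one_add_mul_div_one_add _).log hx.ne'
    have h1 : Tendsto (fun v : ℝ => Real.log (1 + v * f ω) - Real.log (1 + v)) atTop
        (𝓝 (Real.log (f ω))) := by
      refine hr.congr' ?_
      filter_upwards [eventually_ge_atTop 0] with v hv using (key v hv _ hx).2.1
    have h2 : Tendsto (fun v : ℝ => Real.log (1 + -t * v * ((1 + v * f ω) / (1 + v)))
        - Real.log (1 + -t * v * f ω)) atTop (𝓝 0) := by
      refine squeeze_zero_norm' ?_ (a := fun v : ℝ =>
        |Real.log ((1 + v * f ω) / (1 + v)) - Real.log (f ω)|) ?_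
      · filter_upwards [eventually_ge_atTop 0] with v hv using (key v hv _ hx).2.2
      · simpa using (hr.sub_const (Real.log (f ω))).abs
    simpa using (h1.const_mul t).sub h2

/-- for a spectral density `f` with `0 < m ≤ f ≤ M` a.e. on `[0,2π]` and
`∫₀^{2π} log f = 0`, and any fixed `t ≤ 0`, the difference between the limiting `H₁` cumulant
generating functions of the simple quadratic detector,
`Λ₁^{sq}(t;θ) = (t/2) log (σ²/(σ²+θ²))
  - (1/4π) ∫₀^{2π} log (1 - t θ² (σ²+θ² f(ω))/(σ²(σ²+θ²))) dω`,
and of the optimal detector,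
`Λ₁^{opt}(t;θ) = (t/4π) ∫₀^{2π} log (σ²/(σ²+θ² f(ω))) dω
  - (1/4π) ∫₀^{2π} log (1 - t θ² f(ω)/σ²) dω`,
tends to `0` as `θ → ∞`. -/
theorem cgf_difference_vanishes_high_snr
    (σ m M : ℝ) (hσ : 0 < σ) (hm : 0 < m)
    (f : ℝ → ℝ) (hmeas : Measurable f)
    (hae : ∀ᵐ ω ∂(volume.restrict (Set.Icc (0 : ℝ) (2 * Real.pi))), m ≤ f ω ∧ f ω ≤ M)
    (hlog : (∫ ω in (0 : ℝ)..(2 * Real.pi), Real.log (f ω)) = 0)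
    (t : ℝ) (ht : t ≤ 0) :
    Tendsto (fun θ : ℝ =>
        ((t / 2) * Real.log (σ ^ 2 / (σ ^ 2 + θ ^ 2))
          - (1 / (4 * Real.pi)) * ∫ ω in (0 : ℝ)..(2 * Real.pi),
              Real.log (1 - t * θ ^ 2 * (σ ^ 2 + θ ^ 2 * f ω) / (σ ^ 2 * (σ ^ 2 + θ ^ 2))))
        - ((t / (4 * Real.pi)) * (∫ ω in (0 : ℝ)..(2 * Real.pi),
              Real.log (σ ^ 2 / (σ ^ 2 + θ ^ 2 * f ω)))
          - (1 / (4 * Real.pi)) * ∫ ω in (0 : ℝ)..(2 * Real.pi),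
              Real.log (1 - t * θ ^ 2 * f ω / σ ^ 2))) atTop (𝓝 0) := by
  have h2π : (0 : ℝ) ≤ 2 * Real.pi := by positivity
  set μ := volume.restrict (Set.Ioc (0 : ℝ) (2 * Real.pi)) with hμ
  set L := max |Real.log m| |Real.log M|
  have hf : ∀ᵐ ω ∂μ, 0 < f ω ∧ |Real.log (f ω)| ≤ L := by
    filter_upwards [ae_restrict_of_ae_restrict_of_subset Set.Ioc_subset_Icc_self hae] with ω h
    exact ⟨hm.trans_le h.1, abs_log_le_of_mem_Icc hm h⟩
  have hv : Tendsto (fun θ : ℝ => θ ^ 2 / σ ^ 2) atTop atTop :=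
    (tendsto_pow_atTop two_ne_zero).atTop_div_const (by positivity)
  have hlim := ((tendsto_integral_detector_difference hmeas ht hf).comp hv).const_mul
    (1 / (4 * Real.pi))
  have h0 : ∫ ω, t * Real.log (f ω) ∂μ = 0 := by
    rw [integral_const_mul, hμ, ← intervalIntegral.integral_of_le h2π, hlog, mul_zero]
  rw [h0, mul_zero] at hlim
  refine hlim.congr fun θ => ?_
  simp only [Function.comp_apply, intervalIntegral.integral_of_le h2π]
  rw [← hμ]
  set v := θ ^ 2 / σ ^ 2 with hvdef
  have hv0 : 0 ≤ v := by positivity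
  have hs : 0 ≤ -t * v := mul_nonneg (by linarith) hv0
  have hθ : θ ^ 2 = v * σ ^ 2 := by rw [hvdef]; field_simp
  have hlogv : Real.log (σ ^ 2 / (σ ^ 2 + θ ^ 2)) = -Real.log (1 + v) := by
    rw [← Real.log_inv, hθ]
    congr 1
    field_simp
  have hopt : ∫ ω, Real.log (σ ^ 2 / (σ ^ 2 + θ ^ 2 * f ω)) ∂μ
      = -∫ ω, Real.log (1 + v * f ω) ∂μ := by
    rw [← integral_neg]
    refine integral_congr_ae ?_
    filter_upwards [hf] with ω ⟨hx, _⟩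
    rw [← Real.log_inv, hθ]
    congr 1
    field_simp
  have hA : ∀ ω, 1 - t * θ ^ 2 * (σ ^ 2 + θ ^ 2 * f ω) / (σ ^ 2 * (σ ^ 2 + θ ^ 2))
      = 1 + -t * v * ((1 + v * f ω) / (1 + v)) := by
    intro ω
    rw [hθ]
    field_simp
    ring
  have hB : ∀ ω, 1 - t * θ ^ 2 * f ω / σ ^ 2 = 1 + -t * v * f ω := by
    intro ω
    rw [hθ]
    field_simp
    ring
  have hI : ∀ u : ℝ, 0 ≤ u → Integrable (fun ω => Real.log (1 + u * f ω)) μ := by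
    intro u hu
    refine Integrable.of_bound (Measurable.aestronglyMeasurable (by fun_prop))
      (|Real.log (1 + u)| + L) ?_
    filter_upwards [hf] with ω ⟨hx, hL⟩
    exact (abs_log_one_add_mul_le hu hx).trans (by gcongr)
  have hIA : Integrable (fun ω => Real.log (1 + -t * v * ((1 + v * f ω) / (1 + v)))) μ := by
    refine Integrable.of_bound (Measurable.aestronglyMeasurable (by fun_prop))
      (|Real.log (1 + -t * v)| + L) ?_
    filter_upwards [hf] with ω ⟨hx, hL⟩
    refine (abs_log_one_add_mul_le hs (by positivity)).trans (add_le_add_right ?_ _)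
    rw [Real.log_div (by positivity) (by positivity)]
    have h := abs_log_one_add_mul_sub_le hv0 hx one_pos
    rw [mul_one, Real.log_one, sub_zero] at h
    exact h.trans hL
  have hvol : ∫ _, Real.log (1 + v) ∂μ = 2 * Real.pi * Real.log (1 + v) := by
    rw [hμ, ← intervalIntegral.integral_of_le h2π]
    simp
  simp only [hA, hB]
  have e1 : Integrable (fun ω => t * (Real.log (1 + v * f ω) - Real.log (1 + v))) μ :=
    ((hI v hv0).sub (integrable_const _)).const_mul t
  have e2 : Integrable (fun ω => Real.log (1 + -t * v * ((1 + v * f ω) / (1 + v)))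
      - Real.log (1 + -t * v * f ω)) μ := hIA.sub (hI _ hs)
  rw [hlogv, hopt, integral_sub e1 e2, integral_const_mul,
    integral_sub (hI v hv0) (integrable_const _), integral_sub hIA (hI _ hs), hvol]
  field_simp
  ring
end

section
/- (Proposition 1) Let σ > 0 and let f : [0, 2π] → ℝ be measurable with 0 < m ≤ f(ω) ≤ M for almost every ω and ∫₀^{2π} log f(ω) dω = 0. For θ > 0 define Λ₀^{sq}(t;θ) = (t/2)log(σ²/(σ²+θ²)) − (1/2)log(1 − tθ²/(σ²+θ²)) for t·θ²/(σ²+θ²) < 1; Λ₁^{sq}(t;θ) = (t/2)log(σ²/(σ²+θ²)) − (1/4π)∫₀^{2π} log(1 − tθ²(σ²+θ²f(ω))/(σ²(σ²+θ²))) dω for t·θ²(σ²+θ²M)/(σ²(σ²+θ²)) < 1; Λ₀^{opt}(t;θ) = (t/4π)∫₀^{2π} log(σ²/(σ²+θ²f(ω))) dω − (1/4π)∫₀^{2π} log(1 − tθ²f(ω)/(σ²+θ²f(ω))) dω for t·θ²M/(σ²+θ²M) < 1; and Λ₁^{opt}(t;θ) = (t/4π)∫₀^{2π} log(σ²/(σ²+θ²f(ω)))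 dω − (1/4π)∫₀^{2π} log(1 − tθ²f(ω)/σ²) dω for t·θ²M/σ² < 1. Define the error exponents E_{sq}(θ) = min{ sup_t −Λ₀^{sq}(t;θ), sup_t −Λ₁^{sq}(t;θ) } and E_{opt}(θ) = min{ sup_t −Λ₀^{opt}(t;θ), sup_t −Λ₁^{opt}(t;θ) }, each supremum taken over the t in the indicated admissible range. Then the asymptotic relative efficiency satisfies lim_{θ→∞} E_{sq}(θ)/E_{opt}(θ) = 1. -/
open MeasureTheory Filter Topology

/-- An almost everywhere bounded measurable function on `[0, 2π]` has its integral bounded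
accordingly. -/
lemma integral_two_pi_mem_Icc {h : ℝ → ℝ} (hh : Measurable h) {a b : ℝ}
    (hab : ∀ᵐ ω ∂(volume.restrict (Set.Icc (0 : ℝ) (2 * Real.pi))), a ≤ h ω ∧ h ω ≤ b) :
    2 * Real.pi * a ≤ ∫ ω in (0 : ℝ)..(2 * Real.pi), h ω ∧
      ∫ ω in (0 : ℝ)..(2 * Real.pi), h ω ≤ 2 * Real.pi * b := by
  have hpi : (0 : ℝ) ≤ 2 * Real.pi := by positivity
  have hi : IntegrableOn h (Set.Icc (0 : ℝ) (2 * Real.pi)) := by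
    refine Integrable.of_bound hh.aestronglyMeasurable (max |a| |b|) ?_
    filter_upwards [hab] with ω hω
    exact abs_le_max_abs_abs hω.1 hω.2
  have hc (c : ℝ) : IntegrableOn (fun _ : ℝ => c) (Set.Icc (0 : ℝ) (2 * Real.pi)) :=
    integrableOn_const measure_Icc_lt_top.ne
  have hval (c : ℝ) : ∫ _ω in Set.Icc (0 : ℝ) (2 * Real.pi), c = 2 * Real.pi * c := by
    simp [hpi]
  rw [intervalIntegral.integral_of_le hpi, ← integral_Icc_eq_integral_Ioc, ← hval a, ← hval b]
  exact ⟨integral_mono_ae (hc a) hi (hab.mono fun _ h => h.1),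
    integral_mono_ae hi (hc b) (hab.mono fun _ h => h.2)⟩

/-- Bounds for the Legendre-type supremum of `t ↦ (t K + mean log (1 - t g)) / 2` in terms of
almost everywhere bounds on `g`. -/
lemma sSup_exponent_mem_Icc {g : ℝ → ℝ} (hg : Measurable g) {lo hi K : ℝ} (hlo : 0 < lo)
    (hlohi : lo ≤ hi) (hK : 0 < K)
    (hae : ∀ᵐ ω ∂(volume.restrict (Set.Icc (0 : ℝ) (2 * Real.pi))), lo ≤ g ω ∧ g ω ≤ hi)
    {S : Set ℝ}
    (hS : ∀ x, x ∈ S ↔ ∃ t : ℝ, t * hi < 1 ∧ x = t * K / 2 +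
      1 / (4 * Real.pi) * ∫ ω in (0 : ℝ)..(2 * Real.pi), Real.log (1 - t * g ω)) :
    (K / hi - 1 + Real.log (lo / K)) / 2 ≤ sSup S ∧
      sSup S ≤ (K / lo - 1 + Real.log (hi / K)) / 2 := by
  have hpi := Real.pi_pos
  have hhi : 0 < hi := hlo.trans_le hlohi
  have hmeas (t : ℝ) : Measurable fun ω => Real.log (1 - t * g ω) :=
    Real.measurable_log.comp (measurable_const.sub (hg.const_mul t))
  have hub : ∀ x ∈ S, x ≤ (K / lo - 1 + Real.log (hi / K)) / 2 := by
    intro x hx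
    obtain ⟨t, ht, rfl⟩ := (hS x).1 hx
    have hp : 0 < min 1 (1 - t * hi) := lt_min one_pos (by linarith)
    have key := (integral_two_pi_mem_Icc (hmeas t) (a := Real.log (min 1 (1 - t * hi)))
      (b := K / lo - t * K - 1 + Real.log (hi / K)) (by
        filter_upwards [hae] with ω ⟨h1, h2⟩
        have hg0 : 0 < g ω := hlo.trans_le h1
        have hle : min 1 (1 - t * hi) ≤ 1 - t * g ω := by
          rcases le_total t 0 with h | h
          · exact (min_le_left _ _).trans (by nlinarith)
          · exact (min_le_right _ _).trans (by nlinarith)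
        have hy : 0 < 1 - t * g ω := hp.trans_le hle
        refine ⟨Real.log_le_log hp hle, ?_⟩
        have h3 := Real.log_le_sub_one_of_pos (div_pos hy (div_pos hg0 hK))
        rw [Real.log_div hy.ne' (div_pos hg0 hK).ne'] at h3
        have h4 : (1 - t * g ω) / (g ω / K) = K / g ω - t * K := by field_simp
        have h5 : K / g ω ≤ K / lo := by gcongr
        have h6 : Real.log (g ω / K) ≤ Real.log (hi / K) :=
          Real.log_le_log (div_pos hg0 hK) (by gcongr)
        linarith)).2
    have h7 := mul_le_mul_of_nonneg_left key (by positivity : 0 ≤ 1 / (4 * Real.pi))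
    have h8 : 1 / (4 * Real.pi) * (2 * Real.pi * (K / lo - t * K - 1 + Real.log (hi / K)))
        = (K / lo - t * K - 1 + Real.log (hi / K)) / 2 := by
      field_simp; ring
    linarith
  have hmem : ∃ x ∈ S, (K / hi - 1 + Real.log (lo / K)) / 2 ≤ x := by
    set t := 1 / hi - 1 / K with ht
    have hthi : t * hi = 1 - hi / K := by rw [ht]; field_simp
    have htlo : t * lo ≤ 1 - lo / K := by
      have h1 : t * lo = lo / hi - lo / K := by rw [ht]; field_simp
      have h2 : lo / hi ≤ 1 := (div_le_one hhi).2 hlohi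
      linarith
    have hloK : lo / K ≤ hi / K := by gcongr
    have hhiK : 0 < hi / K := by positivity
    refine ⟨_, (hS _).2 ⟨t, by linarith, rfl⟩, ?_⟩
    have key := (integral_two_pi_mem_Icc (hmeas t) (a := Real.log (lo / K))
      (b := |t| * hi) (by
        filter_upwards [hae] with ω ⟨h1, h2⟩
        have hle : lo / K ≤ 1 - t * g ω := by
          rcases le_total t 0 with h | h <;> nlinarith
        have h0 : 0 < lo / K := by positivity
        refine ⟨Real.log_le_log h0 hle, ?_⟩
        have h3 := Real.log_le_sub_one_of_pos (h0.trans_le hle)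
        have h4 : -t * g ω ≤ |t| * hi :=
          mul_le_mul (neg_le_abs t) h2 (by linarith) (abs_nonneg t)
        linarith)).1
    have h7 := mul_le_mul_of_nonneg_left key (by positivity : 0 ≤ 1 / (4 * Real.pi))
    have h8 : 1 / (4 * Real.pi) * (2 * Real.pi * Real.log (lo / K))
        = Real.log (lo / K) / 2 := by
      field_simp; ring
    have h9 : t * K = K / hi - 1 := by rw [ht]; field_simp
    rw [h9]
    linarith
  obtain ⟨x, hxS, hx⟩ := hmem
  exact ⟨hx.trans (le_csSup ⟨_, hub⟩ hxS), csSup_le ⟨x, hxS⟩ hub⟩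

lemma tendsto_exponent_bound {l : Filter ℝ} {ell K u v : ℝ → ℝ} {α β : ℝ} (hαβ : α + β = 1)
    (hell : Tendsto ell l atTop) (hK : Tendsto (fun x => K x / ell x) l (𝓝 1))
    (hv : Tendsto (fun x => (v x)⁻¹) l (𝓝 α)) (hu0 : ∀ᶠ x in l, 0 < u x)
    (hu : Tendsto (fun x => Real.log (u x) / ell x) l (𝓝 β)) :
    Tendsto (fun x => (K x / v x - 1 + Real.log (u x / K x)) / 2 / ell x / (1 / 2)) l (𝓝 1) := by
  have hKtop : Tendsto K l atTop := by
    refine (hK.pos_mul_atTop one_pos hell).congr' ?_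
    filter_upwards [hell.eventually_gt_atTop 0] with x hx
    field_simp
  have hlogK : Tendsto (fun x => Real.log (K x) / ell x) l (𝓝 0) := by
    have h := (Real.isLittleO_log_id_atTop.tendsto_div_nhds_zero.comp hKtop).mul hK
    rw [zero_mul] at h
    refine h.congr' ?_
    filter_upwards [hKtop.eventually_gt_atTop 0] with x hx
    simp only [Function.comp, id]
    field_simp
  have h := (((hK.mul hv).sub hell.inv_tendsto_atTop).add hu).sub hlogK
  rw [one_mul, sub_zero, sub_zero, hαβ] at h
  refine h.congr' ?_
  filter_upwards [hKtop.eventually_gt_atTop 0, hu0, hell.eventually_gt_atTop 0] with x h1 h2 h3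
  rw [Real.log_div h2.ne' h1.ne']
  simp only [Pi.inv_apply]
  field_simp
  ring

/-- A supremum trapped as in `sSup_exponent_mem_Icc` is asymptotic to `ell / 2`. -/
lemma tendsto_of_mem_exponent_Icc {l : Filter ℝ} {ell K lo hi E : ℝ → ℝ} {α β : ℝ}
    (hαβ : α + β = 1)
    (hell : Tendsto ell l atTop) (hK : Tendsto (fun x => K x / ell x) l (𝓝 1))
    (hlo : ∀ᶠ x in l, 0 < lo x) (hhi : ∀ᶠ x in l, 0 < hi x)
    (hlo1 : Tendsto (fun x => (lo x)⁻¹) l (𝓝 α)) (hhi1 : Tendsto (fun x => (hi x)⁻¹) l (𝓝 α))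
    (hlo2 : Tendsto (fun x => Real.log (lo x) / ell x) l (𝓝 β))
    (hhi2 : Tendsto (fun x => Real.log (hi x) / ell x) l (𝓝 β))
    (hE : ∀ᶠ x in l, (K x / hi x - 1 + Real.log (lo x / K x)) / 2 ≤ E x ∧
      E x ≤ (K x / lo x - 1 + Real.log (hi x / K x)) / 2) :
    Tendsto (fun x => E x / ell x / (1 / 2)) l (𝓝 1) := by
  refine tendsto_of_tendsto_of_tendsto_of_le_of_le'
    (tendsto_exponent_bound hαβ hell hK hhi1 hlo hlo2)
    (tendsto_exponent_bound hαβ hell hK hlo1 hhi hhi2) ?_ ?_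
  · filter_upwards [hE, hell.eventually_gt_atTop 0] with x h h0
    have := h.1
    gcongr
  · filter_upwards [hE, hell.eventually_gt_atTop 0] with x h h0
    have := h.2
    gcongr

lemma tendsto_log_div_log_of_linear {h : ℝ → ℝ} {c : ℝ} (hc : 0 < c)
    (hh : Tendsto (fun A => h A / A) atTop (𝓝 c)) :
    Tendsto (fun A => Real.log (h A) / Real.log A) atTop (𝓝 1) := by
  have h1 := (((Real.continuousAt_log hc.ne').tendsto.comp hh).mul
    Real.tendsto_log_atTop.inv_tendsto_atTop).add_const 1
  rw [mul_zero, zero_add] at h1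
  refine h1.congr' ?_
  filter_upwards [hh.eventually_const_lt hc, eventually_gt_atTop 1] with A h2 h3
  have hA : 0 < A := by linarith
  have hl := Real.log_pos h3
  have h4 : h A ≠ 0 := by rintro h0; simp [h0] at h2
  simp only [Function.comp, Pi.inv_apply]
  rw [Real.log_div h4 hA.ne']
  field_simp
  ring

lemma tendsto_log_div_log_of_one {h : ℝ → ℝ} (hh : Tendsto h atTop (𝓝 1)) :
    Tendsto (fun A => Real.log (h A) / Real.log A) atTop (𝓝 0) := by
  have h1 := ((Real.continuousAt_log one_ne_zero).tendsto.comp hh).mul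
    Real.tendsto_log_atTop.inv_tendsto_atTop
  rw [mul_zero] at h1
  exact h1

lemma tendsto_inv_zero_of_linear {h : ℝ → ℝ} {c : ℝ} (hc : 0 < c)
    (hh : Tendsto (fun A => h A / A) atTop (𝓝 c)) :
    Tendsto (fun A => (h A)⁻¹) atTop (𝓝 0) := by
  refine Tendsto.inv_tendsto_atTop ((hh.pos_mul_atTop hc tendsto_id).congr' ?_)
  filter_upwards [eventually_gt_atTop 0] with A hA
  simp only [id]
  field_simp

/-- Exponents for which `g` tends to one, as happens under the noise-only hypothesis. -/
lemma tendsto_exponent_of_tendsto_one {K lo hi E : ℝ → ℝ}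
    (hK : Tendsto (fun x => K x / Real.log x) atTop (𝓝 1))
    (hlo : Tendsto lo atTop (𝓝 1)) (hhi : Tendsto hi atTop (𝓝 1))
    (hE : ∀ᶠ x in atTop, (K x / hi x - 1 + Real.log (lo x / K x)) / 2 ≤ E x ∧
      E x ≤ (K x / lo x - 1 + Real.log (hi x / K x)) / 2) :
    Tendsto (fun x => E x / Real.log x / (1 / 2)) atTop (𝓝 1) :=
  tendsto_of_mem_exponent_Icc (α := 1) (β := 0) (by norm_num) Real.tendsto_log_atTop hK
    (hlo.eventually_const_lt one_pos) (hhi.eventually_const_lt one_pos)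
    (by simpa using hlo.inv₀ one_ne_zero) (by simpa using hhi.inv₀ one_ne_zero)
    (tendsto_log_div_log_of_one hlo) (tendsto_log_div_log_of_one hhi) hE

/-- Exponents for which `g` grows linearly, as happens under the signal hypothesis. -/
lemma tendsto_exponent_of_linear {K lo hi E : ℝ → ℝ} {c C : ℝ} (hc : 0 < c) (hC : 0 < C)
    (hK : Tendsto (fun x => K x / Real.log x) atTop (𝓝 1))
    (hlo : Tendsto (fun x => lo x / x) atTop (𝓝 c))
    (hhi : Tendsto (fun x => hi x / x) atTop (𝓝 C))
    (hE : ∀ᶠ x in atTop, (K x / hi x - 1 + Real.log (lo x / K x)) / 2 ≤ E x ∧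
      E x ≤ (K x / lo x - 1 + Real.log (hi x / K x)) / 2) :
    Tendsto (fun x => E x / Real.log x / (1 / 2)) atTop (𝓝 1) := by
  have hpos {h : ℝ → ℝ} {d : ℝ} (hd : 0 < d) (hh : Tendsto (fun x => h x / x) atTop (𝓝 d)) :
      ∀ᶠ x in atTop, 0 < h x := by
    filter_upwards [hh.eventually_const_lt hd, eventually_gt_atTop 0] with x h1 h2
    exact (div_pos_iff_of_pos_right h2).1 h1
  exact tendsto_of_mem_exponent_Icc (α := 0) (β := 1) (by norm_num) Real.tendsto_log_atTop hK
    (hpos hc hlo) (hpos hC hhi) (tendsto_inv_zero_of_linear hc hlo)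
    (tendsto_inv_zero_of_linear hC hhi)
    (tendsto_log_div_log_of_linear hc hlo) (tendsto_log_div_log_of_linear hC hhi) hE

lemma tendsto_add_mul_div_self (s c : ℝ) :
    Tendsto (fun A : ℝ => (s + A * c) / A) atTop (𝓝 c) := by
  have h := (tendsto_const_nhds (x := s).mul tendsto_inv_atTop_zero).add_const c
  rw [mul_zero, zero_add] at h
  refine h.congr' ?_
  filter_upwards [eventually_gt_atTop 0] with A hA
  field_simp

lemma tendsto_mul_div_add_mul (s : ℝ) {c : ℝ} (hc : 0 < c) :
    Tendsto (fun A : ℝ => A * c / (s + A * c)) atTop (𝓝 1) := by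
  have h := (tendsto_add_mul_div_self s c).inv₀ hc.ne' |>.mul_const c
  rw [inv_mul_cancel₀ hc.ne'] at h
  refine h.congr fun A => ?_
  rw [inv_div]
  ring

lemma tendsto_neg_log_div_log {s c : ℝ} (hs : 0 < s) (hc : 0 < c) :
    Tendsto (fun A : ℝ => -Real.log (s / (s + A * c)) / Real.log A) atTop (𝓝 1) := by
  have h := (tendsto_add_mul_div_self s c).div_const s
  refine (tendsto_log_div_log_of_linear (h := fun A => (s + A * c) / s) (div_pos hc hs)
    (h.congr fun A => by ring)).congr fun A => ?_
  rw [← Real.log_inv, inv_div]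

lemma eventually_pos_of_tendsto_div_log {K : ℝ → ℝ}
    (hK : Tendsto (fun x => K x / Real.log x) atTop (𝓝 1)) : ∀ᶠ x in atTop, 0 < K x := by
  filter_upwards [hK.eventually_const_lt one_pos, eventually_gt_atTop 1] with x h1 h2
  exact (div_pos_iff_of_pos_right (Real.log_pos h2)).1 h1

/-- Proposition 1: the asymptotic relative efficiency of the simple quadratic
detector relative to the optimal detector tends to one as the SNR `θ²/σ²` grows without bound,
for any bounded spectral density `0 < m ≤ f ≤ M` (a.e.) with the unit-power normalization
`∫₀^{2π} log f = 0`.  Here, for each `θ`, the error exponent of each detector is the minimum of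
its false-alarm and miss exponents `sup_t (-Λ_j(t;θ))`, the suprema being taken over the
admissible ranges of `t`, with `Λ_j^{sq}` and `Λ_j^{opt}` the limiting normalized cumulant
generating functions of the simple quadratic and the optimal detector under `H_j`. -/
theorem are_tendsto_one_high_snr
    (σ m M : ℝ) (hσ : 0 < σ) (hm : 0 < m)
    (f : ℝ → ℝ) (hmeas : Measurable f)
    (hae : ∀ᵐ ω ∂(volume.restrict (Set.Icc (0 : ℝ) (2 * Real.pi))), m ≤ f ω ∧ f ω ≤ M)
    (hlog : (∫ ω in (0 : ℝ)..(2 * Real.pi), Real.log (f ω)) = 0)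
    (Esq Eopt : ℝ → ℝ)
    (hEsq : ∀ θ : ℝ, 0 < θ → Esq θ = min
      (sSup {x : ℝ | ∃ t : ℝ, t * θ ^ 2 / (σ ^ 2 + θ ^ 2) < 1 ∧
        x = -((t / 2) * Real.log (σ ^ 2 / (σ ^ 2 + θ ^ 2))
          - (1 / 2) * Real.log (1 - t * θ ^ 2 / (σ ^ 2 + θ ^ 2)))})
      (sSup {x : ℝ | ∃ t : ℝ, t * θ ^ 2 * (σ ^ 2 + θ ^ 2 * M) / (σ ^ 2 * (σ ^ 2 + θ ^ 2)) < 1 ∧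
        x = -((t / 2) * Real.log (σ ^ 2 / (σ ^ 2 + θ ^ 2))
          - (1 / (4 * Real.pi)) * ∫ ω in (0 : ℝ)..(2 * Real.pi),
              Real.log (1 - t * θ ^ 2 * (σ ^ 2 + θ ^ 2 * f ω) / (σ ^ 2 * (σ ^ 2 + θ ^ 2))))}))
    (hEopt : ∀ θ : ℝ, 0 < θ → Eopt θ = min
      (sSup {x : ℝ | ∃ t : ℝ, t * θ ^ 2 * M / (σ ^ 2 + θ ^ 2 * M) < 1 ∧
        x = -((t / (4 * Real.pi)) * (∫ ω in (0 : ℝ)..(2 * Real.pi),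
              Real.log (σ ^ 2 / (σ ^ 2 + θ ^ 2 * f ω)))
          - (1 / (4 * Real.pi)) * ∫ ω in (0 : ℝ)..(2 * Real.pi),
              Real.log (1 - t * θ ^ 2 * f ω / (σ ^ 2 + θ ^ 2 * f ω)))})
      (sSup {x : ℝ | ∃ t : ℝ, t * θ ^ 2 * M / σ ^ 2 < 1 ∧
        x = -((t / (4 * Real.pi)) * (∫ ω in (0 : ℝ)..(2 * Real.pi),
              Real.log (σ ^ 2 / (σ ^ 2 + θ ^ 2 * f ω)))
          - (1 / (4 * Real.pi)) * ∫ ω in (0 : ℝ)..(2 * Real.pi),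
              Real.log (1 - t * θ ^ 2 * f ω / σ ^ 2))})) :
    Tendsto (fun θ : ℝ => Esq θ / Eopt θ) atTop (𝓝 1) := by
  have hpi := Real.pi_pos
  have hs : 0 < σ ^ 2 := by positivity
  generalize σ ^ 2 = s at *
  have hmM : m ≤ M := by
    have : (volume.restrict (Set.Icc (0 : ℝ) (2 * Real.pi))) ≠ 0 := by
      simp [Measure.restrict_eq_zero, hpi]
    have : NeZero (volume.restrict (Set.Icc (0 : ℝ) (2 * Real.pi))) := ⟨this⟩
    obtain ⟨ω, h1, h2⟩ := hae.exists
    exact h1.trans h2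
  have hM : 0 < M := hm.trans_le hmM
  set Ko : ℝ → ℝ := fun A => -(1 / (2 * Real.pi) *
    ∫ ω in (0 : ℝ)..(2 * Real.pi), Real.log (s / (s + A * f ω))) with hKo
  set Ks : ℝ → ℝ := fun A => -Real.log (s / (s + A)) with hKs
  have hKs1 : Tendsto (fun A => Ks A / Real.log A) atTop (𝓝 1) := by
    simpa using tendsto_neg_log_div_log hs one_pos
  have hKo1 : Tendsto (fun A => Ko A / Real.log A) atTop (𝓝 1) := by
    have key : ∀ A : ℝ, 0 < A → -Real.log (s / (s + A * m)) ≤ Ko A ∧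
        Ko A ≤ -Real.log (s / (s + A * M)) := by
      intro A hA
      have h := integral_two_pi_mem_Icc (h := fun ω => Real.log (s / (s + A * f ω)))
        (a := Real.log (s / (s + A * M))) (b := Real.log (s / (s + A * m)))
        (by fun_prop) (by
          filter_upwards [hae] with ω ⟨h1, h2⟩
          have h0 : 0 < f ω := hm.trans_le h1
          constructor <;> apply Real.log_le_log (by positivity) <;> gcongr)
      have h3 : Ko A * (2 * Real.pi) =
          -∫ ω in (0 : ℝ)..(2 * Real.pi), Real.log (s / (s + A * f ω)) := by
        simp only [hKo]; field_simp
      constructor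
      · refine le_of_mul_le_mul_right ?_ (by positivity : 0 < 2 * Real.pi)
        linarith [h.2]
      · refine le_of_mul_le_mul_right ?_ (by positivity : 0 < 2 * Real.pi)
        linarith [h.1]
    refine tendsto_of_tendsto_of_tendsto_of_le_of_le' (tendsto_neg_log_div_log hs hm)
      (tendsto_neg_log_div_log hs hM) ?_ ?_
    · filter_upwards [eventually_gt_atTop 1] with A hA
      have := Real.log_pos hA
      have := (key A (by linarith)).1
      gcongr
    · filter_upwards [eventually_gt_atTop 1] with A hA
      have := Real.log_pos hA
      have := (key A (by linarith)).2
      gcongr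
  have hKs0 := eventually_pos_of_tendsto_div_log hKs1
  have hKo0 := eventually_pos_of_tendsto_div_log hKo1
  have hlin (c : ℝ) : Tendsto (fun A : ℝ => A * (s + A * c) / (s * (s + A)) / A) atTop
      (𝓝 (c / s)) := by
    have h := ((tendsto_add_mul_div_self s c).mul
      (tendsto_mul_div_add_mul s one_pos)).div_const s
    rw [mul_one] at h
    refine h.congr' ?_
    filter_upwards [eventually_gt_atTop 0] with A hA
    field_simp
  have hlin' (c : ℝ) : Tendsto (fun A : ℝ => A * c / s / A) atTop (𝓝 (c / s)) := by
    refine tendsto_const_nhds.congr' ?_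
    filter_upwards [eventually_gt_atTop 0] with A hA
    field_simp
  have hs0 : Tendsto (fun A => sSup {x : ℝ | ∃ t : ℝ, t * A / (s + A) < 1 ∧
        x = -((t / 2) * Real.log (s / (s + A))
          - (1 / 2) * Real.log (1 - t * A / (s + A)))} / Real.log A / (1 / 2)) atTop (𝓝 1) := by
    have h1 : Tendsto (fun A : ℝ => A / (s + A)) atTop (𝓝 1) := by
      simpa using tendsto_mul_div_add_mul s one_pos
    refine tendsto_exponent_of_tendsto_one hKs1 h1 h1 ?_
    filter_upwards [eventually_gt_atTop 0, hKs0] with A hA hK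
    refine sSup_exponent_mem_Icc (g := fun _ => A / (s + A)) measurable_const (by positivity)
      le_rfl hK (by simp) fun x => ?_
    refine exists_congr fun t => ?_
    have e2 : 1 / (4 * Real.pi) * ∫ _ω in (0 : ℝ)..(2 * Real.pi),
        Real.log (1 - t * (A / (s + A))) = 1 / 2 * Real.log (1 - t * (A / (s + A))) := by
      rw [intervalIntegral.integral_const, smul_eq_mul]
      field_simp
      ring
    rw [e2, mul_div_assoc]
    refine and_congr_right fun _ => ?_
    simp only [hKs]
    ring_nf
  have hs1 : Tendsto (fun A => sSup {x : ℝ | ∃ t : ℝ,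
        t * A * (s + A * M) / (s * (s + A)) < 1 ∧
        x = -((t / 2) * Real.log (s / (s + A))
          - (1 / (4 * Real.pi)) * ∫ ω in (0 : ℝ)..(2 * Real.pi),
              Real.log (1 - t * A * (s + A * f ω) / (s * (s + A))))} / Real.log A / (1 / 2))
      atTop (𝓝 1) := by
    refine tendsto_exponent_of_linear (div_pos hm hs) (div_pos hM hs) hKs1 (hlin m) (hlin M) ?_
    filter_upwards [eventually_gt_atTop 0, hKs0] with A hA hK
    refine sSup_exponent_mem_Icc (g := fun ω => A * (s + A * f ω) / (s * (s + A)))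
      (by fun_prop) (by positivity) (by gcongr) hK ?_ fun x => ?_
    · filter_upwards [hae] with ω ⟨h1, h2⟩
      constructor <;> gcongr
    refine exists_congr fun t => ?_
    simp only [mul_assoc t, mul_div_assoc t]
    refine and_congr_right fun _ => ?_
    rw [show ∀ I : ℝ, -(t / 2 * Real.log (s / (s + A)) - I) = t * (Ks A / 2) + I from
      fun I => by simp only [hKs]; ring]
  have ho (A t I : ℝ) : -((t / (4 * Real.pi)) * (∫ ω in (0 : ℝ)..(2 * Real.pi),
      Real.log (s / (s + A * f ω))) - I) = t * Ko A / 2 + I := by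
    simp only [hKo]
    field_simp
    ring
  have ho0 : Tendsto (fun A => sSup {x : ℝ | ∃ t : ℝ, t * A * M / (s + A * M) < 1 ∧
        x = -((t / (4 * Real.pi)) * (∫ ω in (0 : ℝ)..(2 * Real.pi),
              Real.log (s / (s + A * f ω)))
          - (1 / (4 * Real.pi)) * ∫ ω in (0 : ℝ)..(2 * Real.pi),
              Real.log (1 - t * A * f ω / (s + A * f ω)))} / Real.log A / (1 / 2))
      atTop (𝓝 1) := by
    refine tendsto_exponent_of_tendsto_one hKo1 (tendsto_mul_div_add_mul s hm)
      (tendsto_mul_div_add_mul s hM) ?_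
    have hmono {a b A : ℝ} (hA : 0 < A) (ha : 0 < a) (hab : a ≤ b) :
        A * a / (s + A * a) ≤ A * b / (s + A * b) := by
      have hb := ha.trans_le hab
      rw [div_le_div_iff₀ (by positivity) (by positivity)]
      have : s * (A * a) ≤ s * (A * b) := by gcongr
      linarith
    filter_upwards [eventually_gt_atTop 0, hKo0] with A hA hK
    refine sSup_exponent_mem_Icc (g := fun ω => A * f ω / (s + A * f ω))
      (by fun_prop) (by positivity) (hmono hA hm hmM) hK ?_ fun x => ?_
    · filter_upwards [hae] with ω ⟨h1, h2⟩
      exact ⟨hmono hA hm h1, hmono hA (hm.trans_le h1) h2⟩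
    refine exists_congr fun t => ?_
    rw [ho]
    simp only [mul_assoc t, mul_div_assoc t]
  have ho1 : Tendsto (fun A => sSup {x : ℝ | ∃ t : ℝ, t * A * M / s < 1 ∧
        x = -((t / (4 * Real.pi)) * (∫ ω in (0 : ℝ)..(2 * Real.pi),
              Real.log (s / (s + A * f ω)))
          - (1 / (4 * Real.pi)) * ∫ ω in (0 : ℝ)..(2 * Real.pi),
              Real.log (1 - t * A * f ω / s))} / Real.log A / (1 / 2))
      atTop (𝓝 1) := by
    refine tendsto_exponent_of_linear (div_pos hm hs) (div_pos hM hs) hKo1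
      (hlin' m) (hlin' M) ?_
    filter_upwards [eventually_gt_atTop 0, hKo0] with A hA hK
    refine sSup_exponent_mem_Icc (g := fun ω => A * f ω / s)
      (by fun_prop) (by positivity) (by gcongr) hK ?_ fun x => ?_
    · filter_upwards [hae] with ω ⟨h1, h2⟩
      constructor <;> gcongr
    refine exists_congr fun t => ?_
    rw [ho]
    simp only [mul_assoc t, mul_div_assoc t]
  have hsq : Tendsto (fun θ : ℝ => θ ^ 2) atTop atTop := tendsto_pow_atTop two_ne_zero
  have hnum := (hs0.min hs1).comp hsq
  have hden := (ho0.min ho1).comp hsq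
  have hq := hnum.div hden (by simp)
  rw [min_self, div_one] at hq
  refine hq.congr' ?_
  filter_upwards [eventually_gt_atTop 1] with θ hθ
  have hl : 0 < Real.log (θ ^ 2) := Real.log_pos (by nlinarith)
  rw [hEsq θ (by linarith), hEopt θ (by linarith)]
  simp only [Function.comp, Pi.div_apply]
  rw [min_div_div_right (by norm_num : (0 : ℝ) ≤ 1 / 2),
    min_div_div_right (by norm_num : (0 : ℝ) ≤ 1 / 2),
    min_div_div_right hl.le, min_div_div_right hl.le,
    div_div_div_cancel_right₀ (by norm_num), div_div_div_cancel_right₀ hl.ne']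
end
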